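/- arXiv:2310.12896 — 4 statements merged into one kernel-verified Lean document; each statement's English description precedes it below -/
import Mathlib

section
/- The circle through T, L and M is tangent to γ at T; that is, the circumcircle of triangle TLM and the circle γ have a common tangent line at T (equivalently, T, the center D of γ, and the circumcenter of triangle TLM are collinear). -/
open EuclideanGeometry Real RealInnerProductSpace Affine

/-- The Euclidean plane. -/
abbrev Plane := EuclideanSpace ℝ (Fin 2)

theorem core_aux (b c r t h p e1 e2 x y m k : ℝ) (hr : 0 < r) (hb : 0 < b) (hc : 0 < c)
    (ht : t ≠ 0) (hk : 0 < k)
    (he : e1^2 + e2^2 = 1)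
    (hh : h * (b*c - r^2) = 2*r*b*c) (hp : p * (b*c - r^2) = r^2*(b-c))
    (hx : x = p + t*(r*e1 - p)) (hy : y = h + t*(r + r*e2 - h)) (hy0 : 0 < y)
    (hB : (x+b)^2 + y^2 + 2*k*((x+b)*e1 + y*e2) = 0)
    (hC : (x-c)^2 + y^2 + 2*k*((x-c)*e1 + y*e2) = 0)
    (hm : m * (h - y) = h * x - p * y) :
    x*e1 + y*e2 < 0 ∧
    ((x-m)^2 + y^2) * (x*e1+y*e2) = (x^2+y^2) * ((x-m)*e1 + y*e2) := by
  have hBn : (x+b)*e1 + y*e2 < 0 := by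
    by_contra hn
    push Not at hn
    nlinarith only [hB, sq_nonneg (x+b), mul_nonneg hk.le hn, mul_pos hy0 hy0]
  have hCn : (x-c)*e1 + y*e2 < 0 := by
    by_contra hn
    push Not at hn
    nlinarith only [hC, sq_nonneg (x-c), mul_nonneg hk.le hn, mul_pos hy0 hy0]
  have hL : x*e1 + y*e2 < 0 := by
    have : (b+c) * (x*e1+y*e2) < 0 := by
      nlinarith only [mul_pos_of_neg_of_neg hBn (neg_lt_zero.2 hc), mul_pos_of_neg_of_neg hCn (neg_lt_zero.2 hb)]
    by_contra hn
    push Not at hn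
    linarith [mul_nonneg (add_pos hb hc).le hn]
  have hLa : (x-(c-b))*e1 + y*e2 < 0 := by
    have : (b+c) * ((x-(c-b))*e1+y*e2) < 0 := by
      nlinarith only [mul_pos_of_neg_of_neg hBn (neg_lt_zero.2 hb), mul_pos_of_neg_of_neg hCn (neg_lt_zero.2 hc)]
    by_contra hn
    push Not at hn
    linarith [mul_nonneg (add_pos hb hc).le hn]
  refine ⟨hL, ?_⟩
  have hQ : (x*e1+y*e2)*(2*x+b-c) - (x^2+y^2+b*c)*e1 = 0 := by
    have h1 : (2*k*(b+c)) * ((x*e1+y*e2)*(2*x+b-c) - (x^2+y^2+b*c)*e1) = 0 := by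
      linear_combination 2*k*((x-c)*e1 + y*e2) * hB - 2*k*((x+b)*e1 + y*e2) * hC
    have h2 : 2*k*(b+c) ≠ 0 := by positivity
    exact (mul_eq_zero.1 h1).resolve_left h2
  have hd : b*c - r^2 ≠ 0 := by
    intro h0
    rw [h0] at hh
    have : 0 < 2*r*b*c := by positivity
    linarith
  have hK : -x*(b*c)*(1-e2) - y*r*(c-b) - y*(b*c)*e1 - r^2*(1+e2)*x + r^2*y*e1 + r^2*(c-b)*(1+e2)
      + 2*b*c*r*e1 = 0 := by
    have : h = 2*r*b*c/(b*c-r^2) := by field_simp; linarith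
    have hp' : p = r^2*(b-c)/(b*c-r^2) := by field_simp; linarith
    have hK1 : (b*c-r^2) * (-x*(b*c)*(1-e2) - y*r*(c-b) - y*(b*c)*e1 - r^2*(1+e2)*x + r^2*y*e1 + r^2*(c-b)*(1+e2)
      + 2*b*c*r*e1) = 0 := by
      rw [hx, hy]
      linear_combination (1-t)*(-(b*c)*(1-e2) - r^2*(1+e2)) * hp + (1-t)*(-r*(c-b) - b*c*e1 + r^2*e1) * hh
    exact (mul_eq_zero.1 hK1).resolve_left hd
  have hP : (x*e1 + (y-r)*(1+e2)) * (r*(x-(c-b))*e1 - (r*y+b*c)*(1-e2)) = 0 := by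
    linear_combination e1*r*hQ + e1 * hK + (r*y+b*c)*(y-r)*he
  rcases mul_eq_zero.1 hP with hG | hG
  swap
  · exfalso
    have : e2 ≤ 1 := by nlinarith only [sq_nonneg e1, he]
    have h3 : r * ((x-(c-b))*e1 + y*e2) = r*y + b*c*(1-e2) := by linear_combination hG
    have h4 : 0 ≤ b*c*(1-e2) := mul_nonneg (by positivity) (by linarith)
    have h6 : r * ((x-(c-b))*e1 + y*e2) < 0 := mul_neg_of_pos_of_neg hr hLa
    linarith [mul_pos hr hy0]
  · have hm1 : m*(h-(r+r*e2)) = h*(r*e1) - p*(r+r*e2) := by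
      have : t * (m*(h-(r+r*e2)) - (h*(r*e1) - p*(r+r*e2))) = 0 := by
        rw [hx, hy] at hm
        linear_combination hm
      have := (mul_eq_zero.1 this).resolve_left ht
      linarith
    have hm2 : x*(r+r*e2) - y*(r*e1) = m*((r+r*e2) - y) := by
      rw [hx, hy]; linear_combination (1-t)*hm1
    have hw : x*e1+y*e2 = r + r*e2 - y := by linear_combination hG
    by_cases h0 : 1+e2 = 0
    · have e2' : e2 = -1 := by linarith
      have e1' : e1 = 0 := by
        rw [e2'] at he
        have : e1^2 = 0 := by linarith
        exact pow_eq_zero_iff (two_ne_zero) |>.1 this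
      have : m = 0 := by
        rw [e2', e1'] at hm2
        have : m * y = 0 := by linarith
        exact (mul_eq_zero.1 this).resolve_right hy0.ne'
      rw [this]; ring
    · have h5 : x*(1-e2) - r*e1 + y*e1 = 0 := by
        have : (1+e2)*(x*(1-e2) - r*e1 + y*e1) = 0 := by
          linear_combination e1*hG - x*he
        exact (mul_eq_zero.1 this).resolve_left h0
      have hE : (m-2*x)*(x*e1+y*e2) + (x^2+y^2)*e1 = 0 := by
        rw [hw]
        linear_combination -hm2 + y*h5 + x*hG
      linear_combination m*hE

theorem mid_aux (b c h r p d1 d2 ρ : ℝ) (hh : 0 < h) (hr : 0 < r) (hρ : 0 < ρ) (hbc : 0 < b + c)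
    (i1 : 0 < h*b - (p+b)*r) (i1s : (h*b - (p+b)*r)^2 = r^2*((p+b)^2+h^2))
    (i2 : 0 < h*c - (c-p)*r) (i2s : (h*c - (c-p)*r)^2 = r^2*((c-p)^2+h^2))
    (j1 : 0 ≤ h*(d1+b) - (p+b)*d2) (j1s : (h*(d1+b) - (p+b)*d2)^2 = ρ^2*((p+b)^2+h^2))
    (j2 : 0 ≤ h*(c-d1) - (c-p)*d2) (j2s : (h*(c-d1) - (c-p)*d2)^2 = ρ^2*((c-p)^2+h^2)) :
    0 < b ∧ 0 < c ∧ h * (b*c - r^2) = 2*r*b*c ∧ p * (b*c - r^2) = r^2*(b-c) ∧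
    r * d1 = r * p - ρ * p ∧ r * d2 = r * h + ρ * (r - h) := by
  have key : ∀ b q : ℝ, 0 < h*b - q*r → (h*b-q*r)^2 = r^2*(q^2+h^2) →
      h*(b^2-r^2) = 2*b*r*q ∧ 0 < b := by
    intro b q h1 h2
    have h3 : h*(b^2-r^2) = 2*b*r*q := by
      have : h * (h*(b^2-r^2) - 2*b*r*q) = 0 := by linear_combination h2
      have := (mul_eq_zero.1 this).resolve_left hh.ne'
      linarith
    refine ⟨h3, ?_⟩
    by_contra hn
    push Not at hn
    have h4 : 0 ≤ (-b) * (h*b - q*r) := mul_nonneg (by linarith) h1.le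
    have h5 : 0 < h * r^2 := by positivity
    have h6 : 0 ≤ h * b^2 := by positivity
    nlinarith only [h3, h4, h5, h6]
  obtain ⟨k1, hb⟩ := key b (p+b) i1 i1s
  obtain ⟨k2, hc⟩ := key c (c-p) i2 i2s
  have hH : h * (b*c - r^2) = 2*r*b*c := by
    have : (b+c) * (h * (b*c - r^2) - 2*r*b*c) = 0 := by linear_combination c*k1 + b*k2
    have := (mul_eq_zero.1 this).resolve_left hbc.ne'
    linarith
  have hP : p * (b*c - r^2) = r^2*(b-c) := by
    have : (2*b*r*c) * (p * (b*c - r^2) - r^2*(b-c)) = 0 := by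
      linear_combination -c*(b*c-r^2)*k1 + c*(b^2-r^2)*hH
    have := (mul_eq_zero.1 this).resolve_left (by positivity)
    linarith
  have e1 : r * (h*(d1+b) - (p+b)*d2) = ρ * (h*b - (p+b)*r) := by
    apply (sq_eq_sq₀ (by positivity) (by positivity)).1
    linear_combination r^2*j1s - ρ^2*i1s
  have e2 : r * (h*(c-d1) - (c-p)*d2) = ρ * (h*c - (c-p)*r) := by
    apply (sq_eq_sq₀ (by positivity) (by positivity)).1
    linear_combination r^2*j2s - ρ^2*i2s
  have f2 : r * d2 = r * h + ρ * (r - h) := by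
    have : (b+c) * (r * d2 - (r * h + ρ * (r - h))) = 0 := by linear_combination -e1 - e2
    have := (mul_eq_zero.1 this).resolve_left hbc.ne'
    linarith
  refine ⟨hb, hc, hH, hP, ?_, f2⟩
  have : h * (r * d1 - (r * p - ρ * p)) = 0 := by linear_combination e1 + (p+b)*f2
  have := (mul_eq_zero.1 this).resolve_left hh.ne'
  linarith


theorem mem_pair_aux {X Y Z : Plane} (h : Z ∈ affineSpan ℝ ({X, Y} : Set Plane)) :
    ∃ l : ℝ, AffineMap.lineMap X Y l = Z := by
  have h1 := AffineSubspace.vsub_mem_direction h (left_mem_affineSpan_pair ℝ X Y)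
  rw [direction_affineSpan, mem_vectorSpan_pair_rev] at h1
  obtain ⟨l, hl⟩ := h1
  exact ⟨l, by rw [AffineMap.lineMap_apply, hl, vsub_vadd]⟩

theorem weights_aux (A B C : Plane) (hABC : AffineIndependent ℝ ![A, B, C]) :
    (∀ X ∈ convexHull ℝ ({A, B, C} : Set Plane), ∃ a b c : ℝ, 0 ≤ a ∧ 0 ≤ b ∧ 0 ≤ c ∧
      a + b + c = 1 ∧ X = a • A + b • B + c • C) ∧
    (∀ X ∈ interior (convexHull ℝ ({A, B, C} : Set Plane)), ∃ a b c : ℝ, 0 < a ∧ 0 < b ∧ 0 < c ∧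
      a + b + c = 1 ∧ X = a • A + b • B + c • C) := by
  have htop : affineSpan ℝ (Set.range ![A, B, C]) = ⊤ := by
    rw [hABC.affineSpan_eq_top_iff_card_eq_finrank_add_one]
    simp
  let bas : AffineBasis (Fin 3) ℝ Plane := ⟨![A, B, C], hABC, htop⟩
  have hb : (bas : Fin 3 → Plane) = ![A, B, C] := rfl
  have hrange : Set.range bas = ({A, B, C} : Set Plane) := by
    rw [hb]
    simp [Matrix.range_cons]
    try (ext; simp; try tauto)
  have key : ∀ X : Plane, X = bas.coord 0 X • A + bas.coord 1 X • B + bas.coord 2 X • C := by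
    intro X
    have := bas.linear_combination_coord_eq_self X
    rw [Fin.sum_univ_three, hb] at this
    simpa using this.symm
  have ks : ∀ X : Plane, bas.coord 0 X + bas.coord 1 X + bas.coord 2 X = 1 := by
    intro X
    have := bas.sum_coord_apply_eq_one X
    rwa [Fin.sum_univ_three] at this
  rw [← hrange, bas.interior_convexHull, bas.convexHull_eq_nonneg_coord]
  exact ⟨fun X hX => ⟨_, _, _, hX 0, hX 1, hX 2, ks X, key X⟩,
    fun X hX => ⟨_, _, _, hX 0, hX 1, hX 2, ks X, key X⟩⟩

theorem dist_sq_aux (P Q : Plane) : dist P Q ^ 2 = (P 0 - Q 0)^2 + (P 1 - Q 1)^2 := by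
  rw [EuclideanSpace.dist_eq, Real.sq_sqrt (by positivity), Fin.sum_univ_two, Real.dist_eq,
    Real.dist_eq, sq_abs, sq_abs]

theorem coords_aux (A B C L : Plane) (hABC : AffineIndependent ℝ ![A, B, C])
    (hL : L ∈ affineSpan ℝ ({B, C} : Set Plane)) :
    ∃ f g : Plane → ℝ,
      (∀ (a b c : ℝ) (X Y Z : Plane), a + b + c = 1 →
        f (a • X + b • Y + c • Z) = a * f X + b * f Y + c * f Z) ∧
      (∀ (a b c : ℝ) (X Y Z : Plane), a + b + c = 1 →
        g (a • X + b • Y + c • Z) = a * g X + b * g Y + c * g Z) ∧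
      (∀ P Q, dist P Q ^ 2 = (f P - f Q)^2 + (g P - g Q)^2) ∧
      f L = 0 ∧ g L = 0 ∧ g B = 0 ∧ g C = 0 ∧ 0 < g A ∧ f B < f C := by
  obtain ⟨l, rfl⟩ := mem_pair_aux hL
  have hBC : B ≠ C := by
    intro h
    have := hABC.injective.ne (show (1 : Fin 3) ≠ 2 by decide)
    exact this (by simpa using h)
  set R := dist B C with hR
  have hR0 : 0 < R := dist_pos.2 hBC
  have hR2 : R^2 = (B 0 - C 0)^2 + (B 1 - C 1)^2 := dist_sq_aux B C
  set S := (C 0 - B 0) * (A 1 - B 1) - (C 1 - B 1) * (A 0 - B 0) with hS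
  have hS0 : S ≠ 0 := by
    intro h0
    rw [affineIndependent_iff_not_collinear_set] at hABC
    apply hABC
    rw [collinear_iff_of_mem (p₀ := B) (by simp)]
    refine ⟨C - B, ?_⟩
    intro p hp
    simp only [Set.mem_insert_iff, Set.mem_singleton_iff] at hp
    rcases hp with rfl | rfl | rfl
    · refine ⟨((C 0 - B 0) * (p 0 - B 0) + (C 1 - B 1) * (p 1 - B 1)) / R^2, ?_⟩
      ext i
      fin_cases i
      · simp
        field_simp
        linear_combination (p 0 - B 0) * hR2 - (C 1 - B 1) * h0
      · simp
        field_simp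
        linear_combination (p 1 - B 1) * hR2 + (C 0 - B 0) * h0
    · exact ⟨0, by simp⟩
    · exact ⟨1, by simp⟩
  obtain ⟨σ, hσ, hσS⟩ : ∃ σ : ℝ, σ^2 = 1 ∧ 0 < σ * S := by
    rcases lt_or_gt_of_ne hS0 with h | h
    · exact ⟨-1, by norm_num, by linarith⟩
    · exact ⟨1, by norm_num, by linarith⟩
  have hLc : ∀ i, (AffineMap.lineMap B C l : Plane) i = B i + l * (C i - B i) := by
    intro i
    simp [AffineMap.lineMap_apply]; ring
  set L : Plane := AffineMap.lineMap B C l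
  refine ⟨fun P => ((C 0 - B 0) * (P 0 - L 0) + (C 1 - B 1) * (P 1 - L 1)) / R,
    fun P => σ * ((C 0 - B 0) * (P 1 - L 1) - (C 1 - B 1) * (P 0 - L 0)) / R,
    ?_, ?_, ?_, ?_, ?_, ?_, ?_, ?_, ?_⟩
  · intro a b c X Y Z h
    obtain rfl : a = 1 - b - c := by linarith
    simp
    field_simp
    ring
  · intro a b c X Y Z h
    obtain rfl : a = 1 - b - c := by linarith
    simp
    field_simp
    ring
  · intro P Q
    rw [dist_sq_aux]
    field_simp
    rw [hR2]
    linear_combination -((C 0 - B 0) * (P 1 - Q 1) - (C 1 - B 1) * (P 0 - Q 0))^2 * hσ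
  · simp
  · simp
  · simp only [hLc]; field_simp; ring
  · simp only [hLc]; field_simp; ring
  · apply div_pos _ hR0
    simp only [hLc]
    calc 0 < σ * S := hσS
      _ = _ := by rw [hS]; ring
  · apply div_lt_div_of_pos_right _ hR0
    nlinarith [mul_pos hR0 hR0]

theorem infDist_aux (f g : Plane → ℝ)
    (hf : ∀ (a b c : ℝ) (X Y Z : Plane), a + b + c = 1 →
        f (a • X + b • Y + c • Z) = a * f X + b * f Y + c * f Z)
    (hg : ∀ (a b c : ℝ) (X Y Z : Plane), a + b + c = 1 →
        g (a • X + b • Y + c • Z) = a * g X + b * g Y + c * g Z)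
    (hd : ∀ P Q, dist P Q ^ 2 = (f P - f Q)^2 + (g P - g Q)^2)
    (P X Y : Plane) (hXY : X ≠ Y) (ρ : ℝ)
    (h : Metric.infDist P (affineSpan ℝ ({X, Y} : Set Plane) : Set Plane) = ρ) :
    ((f Y - f X) * (g P - g X) - (g Y - g X) * (f P - f X))^2 =
      ρ^2 * ((f Y - f X)^2 + (g Y - g X)^2) := by
  have hline : ∀ l : ℝ, (AffineMap.lineMap X Y l : Plane) = (1-l) • X + l • Y + (0:ℝ) • Y := by
    intro l
    rw [AffineMap.lineMap_apply_module]; simp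
  have hD : 0 < (f Y - f X)^2 + (g Y - g X)^2 := by
    rw [← hd]; exact pow_pos (dist_pos.2 hXY.symm) 2
  set N := (f Y - f X)^2 + (g Y - g X)^2 with hN
  set l₀ := ((f Y - f X) * (f P - f X) + (g Y - g X) * (g P - g X)) / N with hl₀
  have hl₀' : l₀ * N = (f Y - f X) * (f P - f X) + (g Y - g X) * (g P - g X) := by
    rw [hl₀]; field_simp
  have hlen : ∀ l : ℝ, dist P (AffineMap.lineMap X Y l) ^ 2 * N =
      ((f Y - f X) * (g P - g X) - (g Y - g X) * (f P - f X))^2 + ((l - l₀) * N)^2 := by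
    intro l
    rw [hd, hline, hf _ _ _ _ _ _ (by ring), hg _ _ _ _ _ _ (by ring), sub_mul l l₀ N, hl₀', hN]
    ring
  have h1 : ρ = dist P (AffineMap.lineMap X Y l₀) := by
    rw [← h]
    apply le_antisymm
    · exact Metric.infDist_le_dist_of_mem (AffineMap.lineMap_mem_affineSpan_pair _ _ _)
    · rw [Metric.le_infDist ⟨X, left_mem_affineSpan_pair ℝ X Y⟩]
      intro Z hZ
      obtain ⟨l, rfl⟩ := mem_pair_aux hZ
      apply le_of_sq_le_sq _ dist_nonneg
      have e1 := hlen l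
      have e2 := hlen l₀
      rw [sub_self] at e2
      have : dist P (AffineMap.lineMap X Y l₀) ^ 2 * N ≤ dist P (AffineMap.lineMap X Y l) ^ 2 * N := by
        rw [e1, e2]; nlinarith [sq_nonneg ((l-l₀)*N)]
      exact le_of_mul_le_mul_right this hD
  have := hlen l₀
  rw [h1, this]; ring

/-- In the Ajima-circle configuration, let `L` be the touch point of the incircle
with `BC` and `M` the intersection of line `AT` with line `BC`, with `T`, `L`, `M`
not collinear.  Then the circumcircle of `TLM` is tangent to `γ` at `T`: its center
is collinear with `T` and `D`. -/
theorem circle_TLM_tangent_to_gamma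
    (A B C I Oω D T : Plane) (r Rω ρ : ℝ)
    (hABC : AffineIndependent ℝ ![A, B, C])
    (hr : 0 < r)
    (hIin : I ∈ interior (convexHull ℝ ({A, B, C} : Set Plane)))
    (hIab : Metric.infDist I (affineSpan ℝ ({A, B} : Set Plane) : Set Plane) = r)
    (hIbc : Metric.infDist I (affineSpan ℝ ({B, C} : Set Plane) : Set Plane) = r)
    (hIca : Metric.infDist I (affineSpan ℝ ({C, A} : Set Plane) : Set Plane) = r)
    (hRω : 0 < Rω) (hρ : 0 < ρ)
    (hBω : dist B Oω = Rω) (hCω : dist C Oω = Rω)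
    (hγin : Metric.sphere D ρ ⊆ convexHull ℝ ({A, B, C} : Set Plane))
    (hγAB : Metric.infDist D (affineSpan ℝ ({A, B} : Set Plane) : Set Plane) = ρ)
    (hγAC : Metric.infDist D (affineSpan ℝ ({A, C} : Set Plane) : Set Plane) = ρ)
    (hext : dist Oω D = Rω + ρ)
    (hTω : dist T Oω = Rω) (hTγ : dist T D = ρ)
    (hTseg : Wbtw ℝ Oω T D)
    (hTin : T ∈ interior (convexHull ℝ ({A, B, C} : Set Plane)))
    (L M : Plane)
    (hL : L ∈ affineSpan ℝ ({B, C} : Set Plane)) (hLI : dist I L = r)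
    (hM₁ : M ∈ affineSpan ℝ ({A, T} : Set Plane))
    (hM₂ : M ∈ affineSpan ℝ ({B, C} : Set Plane))
    (hTLM : ¬ Collinear ℝ ({T, L, M} : Set Plane)) :
    ∃ (O' : Plane) (R' : ℝ), dist T O' = R' ∧ dist L O' = R' ∧ dist M O' = R' ∧
      Collinear ℝ ({T, D, O'} : Set Plane) := by
  have hline : ∀ (X Y Z : Plane), Z ∈ affineSpan ℝ ({X, Y} : Set Plane) →
      ∃ l : ℝ, Z = (1-l) • X + l • Y + (0:ℝ) • Y := by
    intro X Y Z hZ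
    obtain ⟨l, rfl⟩ := mem_pair_aux hZ
    exact ⟨l, by rw [AffineMap.lineMap_apply_module]; simp⟩
  obtain ⟨hw, hws⟩ := weights_aux A B C hABC
  obtain ⟨f, g, hf, hg, hd, fL, gL, gB, gC, hA, hBC⟩ := coords_aux A B C L hABC hL
  have hAB : A ≠ B := by
    rintro rfl; linarith
  have hAC : A ≠ C := by
    rintro rfl; linarith
  have hBCne : B ≠ C := by
    rintro rfl; exact lt_irrefl _ hBC
  -- the center of γ is in the triangle
  have hDin : D ∈ convexHull ℝ ({A, B, C} : Set Plane) := by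
    have h1 : (2:ℝ) • D - T ∈ Metric.sphere D ρ := by
      rw [mem_sphere_iff_norm, ← hTγ, dist_comm, dist_eq_norm]
      congr 1
      module
    have h2 := (convex_convexHull ℝ ({A, B, C} : Set Plane)) (hγin h1) (hγin (show T ∈ _ from hTγ))
      (show (0:ℝ) ≤ 1/2 by norm_num) (show (0:ℝ) ≤ 1/2 by norm_num) (by norm_num)
    convert h2 using 1
    module
  obtain ⟨u1, u2, u3, hu1, hu2, hu3, hu, hI⟩ := hws I hIin
  obtain ⟨v1, v2, v3, hv1, hv2, hv3, hv, hDw⟩ := hw D hDin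
  obtain ⟨w1, w2, w3, hw1, hw2, hw3, hww, hTw⟩ := hws T hTin
  have fI := hf u1 u2 u3 A B C hu
  have gI := hg u1 u2 u3 A B C hu
  have fD := hf v1 v2 v3 A B C hv
  have gD := hg v1 v2 v3 A B C hv
  have gT := hg w1 w2 w3 A B C hww
  rw [← hI] at fI gI
  rw [← hDw] at fD gD
  rw [← hTw] at gT
  have sIab := infDist_aux f g hf hg hd I A B hAB r hIab
  have sIbc := infDist_aux f g hf hg hd I B C hBCne r hIbc
  have sIca := infDist_aux f g hf hg hd I C A hAC.symm r hIca
  have sDab := infDist_aux f g hf hg hd D A B hAB ρ hγAB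
  have sDac := infDist_aux f g hf hg hd D A C hAC ρ hγAC
  have sLI := hd I L
  have dB := hd B Oω
  have dC := hd C Oω
  have dT := hd T Oω
  have dTD := hd T D
  rw [hLI] at sLI
  rw [hBω] at dB
  rw [hCω] at dC
  rw [hTω] at dT
  rw [hTγ] at dTD
  obtain ⟨k, ⟨hk0, hk1⟩, hk⟩ := hTseg
  have hkR : k * (Rω + ρ) = Rω := by
    rw [← hext, ← hTω, ← hk, dist_lineMap_left, Real.norm_of_nonneg hk0]
  have hkT : T = (1-k) • Oω + k • D + (0:ℝ) • D := by
    rw [← hk, AffineMap.lineMap_apply_module]; simp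
  have fTO := hf (1-k) k 0 Oω D D (by ring)
  have gTO := hg (1-k) k 0 Oω D D (by ring)
  rw [← hkT] at fTO gTO
  obtain ⟨l, hl⟩ := hline _ _ _ hM₁
  obtain ⟨l', hl'⟩ := hline _ _ _ hM₂
  have fM := hf (1-l) l 0 A T T (by ring)
  have gM := hg (1-l) l 0 A T T (by ring)
  have gM' := hg (1-l') l' 0 B C C (by ring)
  rw [← hl] at fM gM
  rw [← hl', gB, gC] at gM'
  have gM0 : g M = 0 := by rw [gM']; ring
  -- real numbers
  have gIr : g I = r := by
    have h1 : 0 < g I := by rw [gI, gB, gC]; nlinarith only [mul_pos hu1 hA]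
    have h2 : (f C - f B)^2 * ((g I)^2 - r^2) = 0 := by
      rw [gB, gC] at sIbc
      linear_combination sIbc
    have h3 := (mul_eq_zero.1 h2).resolve_left (pow_ne_zero 2 (sub_pos.2 hBC).ne')
    exact (sq_eq_sq₀ h1.le hr.le).1 (by linarith)
  have fI0 : f I = 0 := by
    rw [gIr, fL, gL] at sLI
    have : (f I)^2 = 0 := by linarith
    exact pow_eq_zero_iff two_ne_zero |>.1 this
  have hyT : 0 < g T := by rw [gT, gB, gC]; nlinarith only [mul_pos hw1 hA]
  have hq : 0 < g A * (f C - f B) := mul_pos hA (sub_pos.2 hBC)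
  obtain ⟨hb, hc, hH, hP, hd1, hd2⟩ := mid_aux (-f B) (f C) (g A) r (f A) (f D) (g D) ρ hA hr hρ
    (by linarith)
    (by
      have : g A*(-f B) - (f A + -f B)*r = u3 * (g A * (f C - f B)) := by
        rw [gB, gC] at gI
        obtain rfl : u1 = 1 - u2 - u3 := by linarith
        rw [← gIr]
        linear_combination g A * fI - g A * fI0 - (f A - f B) * gI
      rw [this]; exact mul_pos hu3 hq)
    (by
      rw [gIr, fI0, gB] at sIab
      linear_combination sIab)
    (by
      have : g A*(f C) - (f C - f A)*r = u2 * (g A * (f C - f B)) := by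
        rw [gB, gC] at gI
        obtain rfl : u1 = 1 - u2 - u3 := by linarith
        rw [← gIr]
        linear_combination -g A * fI + g A * fI0 - (f C - f A) * gI
      rw [this]; exact mul_pos hu2 hq)
    (by
      rw [gIr, fI0, gC] at sIca
      linear_combination sIca)
    (by
      have : g A*(f D + -f B) - (f A + -f B)*g D = v3 * (g A * (f C - f B)) := by
        rw [gB, gC] at gD
        obtain rfl : v1 = 1 - v2 - v3 := by linarith
        linear_combination g A * fD - (f A - f B) * gD
      rw [this]; exact mul_nonneg hv3 hq.le)
    (by
      rw [gB] at sDab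
      linear_combination sDab)
    (by
      have : g A*(f C - f D) - (f C - f A)*g D = v2 * (g A * (f C - f B)) := by
        rw [gB, gC] at gD
        obtain rfl : v1 = 1 - v2 - v3 := by linarith
        linear_combination -g A * fD - (f C - f A) * gD
      rw [this]; exact mul_nonneg hv2 hq.le)
    (by
      rw [gC] at sDac
      linear_combination sDac)
  have fO : ρ * (f Oω - f T) = Rω * (f T - f D) := by
    rw [fTO]; linear_combination (f Oω - f D) * hkR
  have gO : ρ * (g Oω - g T) = Rω * (g T - g D) := by
    rw [gTO]; linear_combination (g Oω - g D) * hkR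
  obtain ⟨e1, he1⟩ : ∃ e, e = (f T - f D) / ρ := ⟨_, rfl⟩
  obtain ⟨e2, he2⟩ : ∃ e, e = (g T - g D) / ρ := ⟨_, rfl⟩
  have he1' : f T - f D = ρ * e1 := by rw [he1]; field_simp
  have he2' : g T - g D = ρ * e2 := by rw [he2]; field_simp
  have hee : e1^2 + e2^2 = 1 := by
    rw [he1', he2'] at dTD
    have : ρ^2 * (e1^2 + e2^2 - 1) = 0 := by linear_combination -dTD
    have := (mul_eq_zero.1 this).resolve_left (by positivity)
    linarith
  have fO' : f Oω = f T + Rω * e1 := by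
    rw [he1'] at fO
    have : ρ * (f Oω - (f T + Rω * e1)) = 0 := by linear_combination fO
    have := (mul_eq_zero.1 this).resolve_left hρ.ne'
    linarith
  have gO' : g Oω = g T + Rω * e2 := by
    rw [he2'] at gO
    have : ρ * (g Oω - (g T + Rω * e2)) = 0 := by linear_combination gO
    have := (mul_eq_zero.1 this).resolve_left hρ.ne'
    linarith
  obtain ⟨hneg, hfin⟩ := core_aux (-f B) (f C) r (ρ / r) (g A) (f A) e1 e2 (f T) (g T) (f M) Rω
    hr hb hc (by positivity) hRω hee hH hP
    (by
      field_simp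
      linear_combination r * he1' + hd1)
    (by
      field_simp
      linear_combination r * he2' + hd2)
    hyT
    (by
      rw [fO', gO', gB] at dB
      linear_combination -dB - Rω^2 * hee)
    (by
      rw [fO', gO', gC] at dC
      linear_combination -dC - Rω^2 * hee)
    (by
      rw [gM0] at gM
      have h1 : l * (g A - g T) = g A := by linear_combination gM
      linear_combination (g A - g T) * fM - (f A - f T) * h1)
  set w := f T * e1 + g T * e2 with hwdef
  obtain ⟨s, hs⟩ : ∃ s : ℝ, (f T)^2 + (g T)^2 + 2 * s * w = 0 :=
    ⟨-((f T)^2 + (g T)^2) / (2 * w), by have := hneg.ne; field_simp; ring⟩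
  obtain ⟨O', hO'⟩ : ∃ O' : Plane, O' = (1 + s/ρ) • T + (-(s/ρ)) • D + (0:ℝ) • D := ⟨_, rfl⟩
  have fO1 := hf (1+s/ρ) (-(s/ρ)) 0 T D D (by ring)
  have gO1 := hg (1+s/ρ) (-(s/ρ)) 0 T D D (by ring)
  rw [← hO'] at fO1 gO1
  have fO2 : f O' = f T + s * e1 := by
    rw [fO1, he1]; field_simp; ring
  have gO2 : g O' = g T + s * e2 := by
    rw [gO1, he2]; field_simp; ring
  refine ⟨O', dist T O', rfl, ?_, ?_, ?_⟩
  · apply (sq_eq_sq₀ dist_nonneg dist_nonneg).1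
    rw [hd, hd, fO2, gO2, fL, gL]
    linear_combination hs
  · apply (sq_eq_sq₀ dist_nonneg dist_nonneg).1
    rw [hd, hd, fO2, gO2, gM0]
    have : w * ((f T - f M)^2 + (g T)^2 + 2 * s * ((f T - f M) * e1 + g T * e2)) = 0 := by
      linear_combination hfin + ((f T - f M) * e1 + g T * e2) * hs
    have := (mul_eq_zero.1 this).resolve_left hneg.ne
    linear_combination this
  · rw [collinear_iff_of_mem (p₀ := T) (by simp)]
    refine ⟨D - T, ?_⟩
    intro p hp
    simp only [Set.mem_insert_iff, Set.mem_singleton_iff] at hp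
    rcases hp with rfl | rfl | rfl
    · exact ⟨0, by simp⟩
    · exact ⟨1, by simp⟩
    · refine ⟨-(s/ρ), ?_⟩
      rw [hO', vadd_eq_add]
      module
end

section
/- The four points X, T, L and K are concyclic. -/
open EuclideanGeometry Real RealInnerProductSpace Affine

lemma aux_dist (P Q : Plane) (d : ℝ) (h : dist P Q = d) :
    (P 0 - Q 0)^2 + (P 1 - Q 1)^2 = d^2 := by
  rw [← h, EuclideanSpace.dist_eq, Real.sq_sqrt (by positivity)]
  simp [Fin.sum_univ_two, Real.dist_eq, sq_abs]

lemma aux_mem (P A B : Plane) (h : P ∈ affineSpan ℝ ({A, B} : Set Plane)) :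
    ∃ t : ℝ, P 0 - A 0 = t * (B 0 - A 0) ∧ P 1 - A 1 = t * (B 1 - A 1) := by
  obtain ⟨t, rfl⟩ := (mem_affineSpan_pair_iff_exists_lineMap_eq).1 h
  refine ⟨t, ?_, ?_⟩ <;> simp [AffineMap.lineMap_apply]

lemma aux_mem' (P A B : Plane) (t : ℝ) (h0 : P 0 - A 0 = t * (B 0 - A 0))
    (h1 : P 1 - A 1 = t * (B 1 - A 1)) : P ∈ affineSpan ℝ ({A, B} : Set Plane) := by
  refine (mem_affineSpan_pair_iff_exists_lineMap_eq).2 ⟨t, ?_⟩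
  ext i
  fin_cases i <;> simp [AffineMap.lineMap_apply] <;> linarith

lemma aux_foot (P A B : Plane) (d : ℝ)
    (h : Metric.infDist P (affineSpan ℝ ({A, B} : Set Plane) : Set Plane) = d) :
    ∃ Q : Plane, Q ∈ affineSpan ℝ ({A, B} : Set Plane) ∧ dist P Q = d ∧
      (P 0 - Q 0) * (B 0 - A 0) + (P 1 - Q 1) * (B 1 - A 1) = 0 := by
  have hA : A ∈ affineSpan ℝ ({A, B} : Set Plane) := left_mem_affineSpan_pair ℝ A B
  have hB : B ∈ affineSpan ℝ ({A, B} : Set Plane) := right_mem_affineSpan_pair ℝ A B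
  haveI : Nonempty (affineSpan ℝ ({A, B} : Set Plane)) := ⟨⟨A, hA⟩⟩
  refine ⟨EuclideanGeometry.orthogonalProjection (affineSpan ℝ ({A, B} : Set Plane)) P,
    EuclideanGeometry.orthogonalProjection_mem P, ?_, ?_⟩
  · rw [← h]
    exact EuclideanGeometry.dist_orthogonalProjection_eq_infDist _ P
  · have h1 := EuclideanGeometry.vsub_orthogonalProjection_mem_direction_orthogonal
      (affineSpan ℝ ({A, B} : Set Plane)) P
    have h2 := (Submodule.mem_orthogonal _ _).1 h1 (B -ᵥ A)
      (AffineSubspace.vsub_mem_direction hB hA)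
    simp [PiLp.inner_apply, Fin.sum_univ_two] at h2
    linarith

lemma aux_cross (P A B : Plane) (d : ℝ)
    (h : Metric.infDist P (affineSpan ℝ ({A, B} : Set Plane) : Set Plane) = d) :
    ((P 0 - A 0) * (B 1 - A 1) - (P 1 - A 1) * (B 0 - A 0))^2
      = d^2 * ((B 0 - A 0)^2 + (B 1 - A 1)^2) := by
  obtain ⟨Q, hQ, hd, ho⟩ := aux_foot P A B d h
  obtain ⟨t, h0, h1⟩ := aux_mem Q A B hQ
  have hd := aux_dist _ _ _ hd
  have e : (P 0 - A 0) * (B 1 - A 1) - (P 1 - A 1) * (B 0 - A 0)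
     = (P 0 - Q 0) * (B 1 - A 1) - (P 1 - Q 1) * (B 0 - A 0) := by
    linear_combination (B 1 - A 1) * h0 - (B 0 - A 0) * h1
  rw [e, ← hd]
  linear_combination (-((P 0 - Q 0) * (B 0 - A 0) + (P 1 - Q 1) * (B 1 - A 1))) * ho

lemma aux_perp (P A B L : Plane) (d : ℝ)
    (h : Metric.infDist P (affineSpan ℝ ({A, B} : Set Plane) : Set Plane) = d)
    (hL : L ∈ affineSpan ℝ ({A, B} : Set Plane)) (hLd : dist P L = d) :
    (P 0 - L 0) * (B 0 - A 0) + (P 1 - L 1) * (B 1 - A 1) = 0 := by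
  obtain ⟨Q, hQ, hd, ho⟩ := aux_foot P A B d h
  obtain ⟨t, h0, h1⟩ := aux_mem Q A B hQ
  obtain ⟨s, k0, k1⟩ := aux_mem L A B hL
  have hd := aux_dist _ _ _ hd
  have hLd := aux_dist _ _ _ hLd
  have e0 : L 0 - Q 0 = (s - t) * (B 0 - A 0) := by linarith
  have e1 : L 1 - Q 1 = (s - t) * (B 1 - A 1) := by linarith
  have : (L 0 - Q 0)^2 + (L 1 - Q 1)^2 = 0 := by
    linear_combination hLd - hd + 2 * (P 0 - Q 0) * e0 + 2 * (P 1 - Q 1) * e1 + 2 * (s - t) * ho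
  have z0 : L 0 - Q 0 = 0 := by nlinarith [sq_nonneg (L 0 - Q 0), sq_nonneg (L 1 - Q 1)]
  have z1 : L 1 - Q 1 = 0 := by nlinarith [sq_nonneg (L 0 - Q 0), sq_nonneg (L 1 - Q 1)]
  rw [sub_eq_zero.1 z0, sub_eq_zero.1 z1]; exact ho

lemma aux_hull (P A B C : Plane) (h : P ∈ convexHull ℝ ({A, B, C} : Set Plane)) :
    ∃ β γ : ℝ, 0 ≤ β ∧ 0 ≤ γ ∧ β + γ ≤ 1 ∧ ∀ i, P i - A i = β * (B i - A i) + γ * (C i - A i) := by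
  rw [convexHull_insert (by simp), mem_convexJoin] at h
  obtain ⟨a, ha, y, hy, hP⟩ := h
  rw [Set.mem_singleton_iff] at ha
  subst ha
  rw [convexHull_pair] at hy
  obtain ⟨u, v, hu, hv, huv, rfl⟩ := hy
  obtain ⟨p, q, hp, hq, hpq, rfl⟩ := hP
  refine ⟨q * u, q * v, by positivity, by positivity, ?_, ?_⟩
  · rw [← mul_add, huv]; linarith
  · intro i
    obtain rfl : p = 1 - q := by linarith
    obtain rfl : u = 1 - v := by linarith
    simp
    ring

lemma aux_center (A O : Plane) (ρ : ℝ) (hρ : 0 < ρ) (S : Set Plane) (hS : Convex ℝ S)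
    (h : Metric.sphere O ρ ⊆ S) : O ∈ S := by
  let e : Plane := !₂[ρ, 0]
  have he : ‖e‖ = ρ := by
    simp [e, EuclideanSpace.norm_eq, Fin.sum_univ_two, hρ.le]
  have h1 : O + e ∈ S := h (by simp [he])
  have h2 : O - e ∈ S := h (by simp [he])
  have := hS h1 h2 (a := 1/2) (b := 1/2) (by norm_num) (by norm_num) (by norm_num)
  convert this using 1
  module

lemma aux_indep (A B C : Plane) (h : AffineIndependent ℝ ![A, B, C]) :
    (C 0 - A 0) * (B 1 - A 1) - (C 1 - A 1) * (B 0 - A 0) ≠ 0 := by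
  intro hD
  have hAB : A ≠ B := by
    intro e
    have := h.injective.ne (show (0 : Fin 3) ≠ 1 by decide)
    exact this (by simpa using e)
  rw [affineIndependent_iff_not_collinear_set] at h
  apply h
  have hAB2 : (B 0 - A 0)^2 + (B 1 - A 1)^2 ≠ 0 := by
    intro e
    apply hAB
    ext i
    fin_cases i
    · show A 0 = B 0
      nlinarith [sq_nonneg (B 0 - A 0), sq_nonneg (B 1 - A 1)]
    · show A 1 = B 1
      nlinarith [sq_nonneg (B 0 - A 0), sq_nonneg (B 1 - A 1)]
  have : C ∈ affineSpan ℝ ({A, B} : Set Plane) := by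
    apply aux_mem' C A B (((C 0 - A 0) * (B 0 - A 0) + (C 1 - A 1) * (B 1 - A 1)) / ((B 0 - A 0)^2 + (B 1 - A 1)^2))
    · field_simp
      linear_combination (B 1 - A 1) * hD
    · field_simp
      linear_combination -(B 0 - A 0) * hD
  have := collinear_insert_of_mem_affineSpan_pair this
  rwa [show ({A, B, C} : Set Plane) = {C, A, B} by ext; simp; tauto]

lemma aux_scale (c ρ r D n x y : ℝ) (hr : 0 < r) (hρ : 0 < ρ) (hD : D ≠ 0) (hx : 0 ≤ x) (hy : 0 ≤ y)
    (h1 : (x * D)^2 = r^2 * n) (h2 : (y * D)^2 = ρ^2 * n) : y * r = ρ * x := by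
  have : (y * r)^2 = (ρ * x)^2 := by
    have hD2 : D^2 ≠ 0 := by positivity
    apply mul_right_cancel₀ hD2
    linear_combination r^2 * h2 - ρ^2 * h1
  exact (pow_left_inj₀ (by positivity) (by positivity) two_ne_zero).1 this

lemma aux_root (r ρ n m s s' : ℝ) (hr : 0 < r) (hρ : 0 < ρ) (npos : 0 < n) (hpos : 0 < m)
    (hnm : 0 ≤ n - 2 * m) (hss : s'^2 < s^2)
    (Q1 : (r * s' - ρ) * (n * (r * s') - ρ * (n - 2 * m)) = 0)
    (Q2 : (r * s - ρ) * (n * (r * s) - ρ * (n - 2 * m)) = 0) : r * s = ρ := by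
  rcases mul_eq_zero.1 Q2 with h | h
  · linarith
  exfalso
  rcases mul_eq_zero.1 Q1 with h' | h'
  · have e1 : r * s' = ρ := by linarith
    have e2 : n * (r * s) < n * ρ := by nlinarith
    have e3 : r * s < ρ := lt_of_mul_lt_mul_left e2 npos.le
    have e4 : 0 ≤ n * (r * s) := by nlinarith
    have e5 : 0 ≤ r * s := nonneg_of_mul_nonneg_right e4 npos
    have e6 : (r * s')^2 < (r * s)^2 := by
      rw [mul_pow, mul_pow]; gcongr
    nlinarith
  · have : n * (r * s') = n * (r * s) := by linarith
    have := mul_left_cancel₀ hr.ne' (mul_left_cancel₀ npos.ne' this)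
    rw [this] at hss
    exact lt_irrefl _ hss

lemma aux_sq (a b : ℝ) (h : a^2 + b^2 = 0) : a = 0 ∧ b = 0 := by
  constructor <;> nlinarith [sq_nonneg a, sq_nonneg b]

set_option maxHeartbeats 2000000 in
/-- Let `γ` (center `O`, radius `ρ`) be a circle inscribed in angle `BAC` lying
inside triangle `ABC`, `L` the touch point of the incircle with `BC`, `X` and `L'`
the intersections of line `AL` with `γ` (`X` closer to `A`), `T` a point of `γ` on
the opposite side of line `AL` from `B`, and `K` the intersection of line `TL'` with
line `CB`.  Then `X`, `T`, `L`, `K` are concyclic. -/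
theorem XTLK_concyclic
    (A B C I O : Plane) (r ρ : ℝ)
    (hABC : AffineIndependent ℝ ![A, B, C])
    (hr : 0 < r)
    (hIin : I ∈ interior (convexHull ℝ ({A, B, C} : Set Plane)))
    (hIab : Metric.infDist I (affineSpan ℝ ({A, B} : Set Plane) : Set Plane) = r)
    (hIbc : Metric.infDist I (affineSpan ℝ ({B, C} : Set Plane) : Set Plane) = r)
    (hIca : Metric.infDist I (affineSpan ℝ ({C, A} : Set Plane) : Set Plane) = r)
    (hρ : 0 < ρ)
    (hγin : Metric.sphere O ρ ⊆ convexHull ℝ ({A, B, C} : Set Plane))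
    (hγAB : Metric.infDist O (affineSpan ℝ ({A, B} : Set Plane) : Set Plane) = ρ)
    (hγAC : Metric.infDist O (affineSpan ℝ ({A, C} : Set Plane) : Set Plane) = ρ)
    (hbis : ∠ B A O = ∠ O A C)
    (L X L' T K : Plane)
    (hL : L ∈ affineSpan ℝ ({B, C} : Set Plane)) (hLI : dist I L = r)
    (hX : X ∈ affineSpan ℝ ({A, L} : Set Plane)) (hXγ : dist O X = ρ)
    (hL' : L' ∈ affineSpan ℝ ({A, L} : Set Plane)) (hL'γ : dist O L' = ρ)
    (hXL' : X ≠ L') (hXcloser : dist A X < dist A L')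
    (hT : dist O T = ρ)
    (hTside : (affineSpan ℝ ({A, L} : Set Plane)).SOppSide T B)
    (hK₁ : K ∈ affineSpan ℝ ({T, L'} : Set Plane))
    (hK₂ : K ∈ affineSpan ℝ ({C, B} : Set Plane)) :
    EuclideanGeometry.Concyclic ({X, T, L, K} : Set Plane) := by
  have hD := aux_indep A B C hABC
  obtain ⟨β, γ, hβ, hγ, hβγ, hI⟩ := aux_hull I A B C (interior_subset hIin)
  obtain ⟨β', γ', hβ', hγ', -, hO⟩ := aux_hull O A B C
    (aux_center A O ρ hρ _ (convex_convexHull ℝ _) hγin)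
  have hI0 := hI 0
  have hI1 := hI 1
  have hO0 := hO 0
  have hO1 := hO 1
  rw [Set.pair_comm] at hIca
  have c1 := aux_cross _ _ _ _ hIab
  have c2 := aux_cross _ _ _ _ hIca
  have c3 := aux_cross _ _ _ _ hγAB
  have c4 := aux_cross _ _ _ _ hγAC
  rw [hI0, hI1] at c1 c2
  rw [hO0, hO1] at c3 c4
  have g1 : γ' * r = ρ * γ := aux_scale 0 ρ r _ _ γ γ' hr hρ hD hγ hγ'
    (by rw [← c1]; ring) (by rw [← c3]; ring)
  have g2 : β' * r = ρ * β := aux_scale 0 ρ r _ _ β β' hr hρ hD hβ hβ'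
    (by rw [← c2]; ring) (by rw [← c4]; ring)
  have q0 : r * (O 0 - A 0) = ρ * (I 0 - A 0) := by
    rw [hI0, hO0]; linear_combination (B 0 - A 0) * g2 + (C 0 - A 0) * g1
  have q1 : r * (O 1 - A 1) = ρ * (I 1 - A 1) := by
    rw [hI1, hO1]; linear_combination (B 1 - A 1) * g2 + (C 1 - A 1) * g1
  have hperp := aux_perp _ _ _ _ _ hIbc hL hLI
  have dIL := aux_dist _ _ _ hLI
  obtain ⟨l, l0, l1⟩ := aux_mem _ _ _ hL
  -- the inner product of `A - L` and `I - L` is positive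
  have hα : (1 - β - γ) * ((A 0 - L 0) * (I 0 - L 0) + (A 1 - L 1) * (I 1 - L 1)) = r^2 := by
    have e0 : I 0 - L 0 = (1 - β - γ) * (A 0 - L 0) + (γ - (β + γ) * l) * (C 0 - B 0) := by
      linear_combination hI0 - (β + γ) * l0
    have e1 : I 1 - L 1 = (1 - β - γ) * (A 1 - L 1) + (γ - (β + γ) * l) * (C 1 - B 1) := by
      linear_combination hI1 - (β + γ) * l1
    linear_combination dIL - (I 0 - L 0) * e0 - (I 1 - L 1) * e1 - (γ - (β + γ) * l) * hperp
  have hpos : 0 < (A 0 - L 0) * (I 0 - L 0) + (A 1 - L 1) * (I 1 - L 1) := by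
    by_contra hcon
    push Not at hcon
    have h3 : 0 ≤ 1 - β - γ := by linarith
    have h4 := mul_nonpos_of_nonneg_of_nonpos h3 hcon
    rw [hα] at h4
    have : 0 < r^2 := by positivity
    exact absurd h4 (not_le.2 this)
  have hIA : r ^ 2 ≤ (I 0 - A 0)^2 + (I 1 - A 1)^2 := by
    rw [aux_dist I A _ rfl]
    have : r ≤ dist I A := by
      rw [← hIab]; exact Metric.infDist_le_dist_of_mem (left_mem_affineSpan_pair ℝ A B)
    gcongr
  obtain ⟨s', x0, x1⟩ := aux_mem _ _ _ hX
  obtain ⟨s, y0, y1⟩ := aux_mem _ _ _ hL'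
  have dX := aux_dist _ _ _ hXγ
  have dL' := aux_dist _ _ _ hL'γ
  have dT := aux_dist _ _ _ hT
  have hTn : T ∉ affineSpan ℝ ({A, L} : Set Plane) := hTside.2.1
  have hss : s'^2 < s^2 := by
    have e1 := aux_dist A X _ rfl
    have e2 := aux_dist A L' _ rfl
    have e3 : dist A X ^ 2 < dist A L' ^ 2 := by gcongr
    rw [← e1, ← e2] at e3
    have e4 : s'^2 * ((L 0 - A 0)^2 + (L 1 - A 1)^2) < s^2 * ((L 0 - A 0)^2 + (L 1 - A 1)^2) := by
      calc _ = (A 0 - X 0)^2 + (A 1 - X 1)^2 := by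
            linear_combination -(X 0 - A 0 + s' * (L 0 - A 0)) * x0 - (X 1 - A 1 + s' * (L 1 - A 1)) * x1
        _ < _ := e3
        _ = _ := by
            linear_combination (L' 0 - A 0 + s * (L 0 - A 0)) * y0 + (L' 1 - A 1 + s * (L 1 - A 1)) * y1
    exact lt_of_mul_lt_mul_right e4 (by positivity)
  set n := (L 0 - A 0)^2 + (L 1 - A 1)^2 with hn
  set m := (A 0 - L 0) * (I 0 - L 0) + (A 1 - L 1) * (I 1 - L 1) with hm
  have npos : 0 < n := by
    rcases eq_or_ne n 0 with h | h
    · obtain ⟨z0, z1⟩ := aux_sq _ _ h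
      have : m = 0 := by
        rw [hm]; linear_combination -(I 0 - L 0) * z0 - (I 1 - L 1) * z1
      linarith
    · have : 0 ≤ n := by positivity
      exact lt_of_le_of_ne this h.symm
  -- quadratic for both parameters
  have quad : ∀ (Y : Plane) (t : ℝ), Y 0 - A 0 = t * (L 0 - A 0) → Y 1 - A 1 = t * (L 1 - A 1) →
      (O 0 - Y 0)^2 + (O 1 - Y 1)^2 = ρ^2 → (r * t - ρ) * (n * (r * t) - ρ * (n - 2 * m)) = 0 := by
    intro Y t h0 h1 h2
    have k0 : r * (O 0 - Y 0) = ρ * (I 0 - A 0) - r * t * (L 0 - A 0) := by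
      linear_combination q0 - r * h0
    have k1 : r * (O 1 - Y 1) = ρ * (I 1 - A 1) - r * t * (L 1 - A 1) := by
      linear_combination q1 - r * h1
    have k2 : (ρ * (I 0 - A 0) - r * t * (L 0 - A 0))^2 + (ρ * (I 1 - A 1) - r * t * (L 1 - A 1))^2
        = r^2 * ρ^2 := by
      rw [← k0, ← k1, ← h2]; ring
    rw [hn, hm]
    linear_combination k2 - ρ^2 * dIL
  have Q1 := quad X s' x0 x1 dX
  have Q2 := quad L' s y0 y1 dL'
  have hnm : 0 ≤ n - 2 * m := by
    have : n - 2 * m = (I 0 - A 0)^2 + (I 1 - A 1)^2 - r^2 := by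
      rw [← dIL, hn, hm]; ring
    linarith
  have hs : r * s = ρ := aux_root r ρ n m s s' hr hρ npos hpos hnm hss Q1 Q2
  have n0 : r * (O 0 - L' 0) = ρ * (I 0 - L 0) := by
    linear_combination q0 - r * y0 - (L 0 - A 0) * hs
  have n1 : r * (O 1 - L' 1) = ρ * (I 1 - L 1) := by
    linear_combination q1 - r * y1 - (L 1 - A 1) * hs
  obtain ⟨k, k0, k1⟩ := aux_mem _ _ _ hK₂
  obtain ⟨j, j0, j1⟩ := aux_mem _ _ _ hK₁
  have nperp : (O 0 - L' 0) * (C 0 - B 0) + (O 1 - L' 1) * (C 1 - B 1) = 0 := by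
    apply mul_left_cancel₀ hr.ne'
    linear_combination (C 0 - B 0) * n0 + (C 1 - B 1) * n1 + ρ * hperp
  have hKL : (O 0 - L' 0) * (K 0 - L 0) + (O 1 - L' 1) * (K 1 - L 1) = 0 := by
    linear_combination (O 0 - L' 0) * k0 + (O 1 - L' 1) * k1 - (O 0 - L' 0) * l0 - (O 1 - L' 1) * l1
      + (1 - k - l) * nperp
  have hs's : s' - s ≠ 0 := by
    intro h
    rw [sub_eq_zero.1 h] at hss
    exact lt_irrefl _ hss
  -- `L = L' + p (X - L')`
  obtain ⟨p, p0, p1⟩ : ∃ p : ℝ, L 0 - L' 0 = p * (X 0 - L' 0) ∧ L 1 - L' 1 = p * (X 1 - L' 1) := by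
    refine ⟨(1 - s) / (s' - s), ?_, ?_⟩
    · rw [show X 0 - L' 0 = (s' - s) * (L 0 - A 0) by linarith, ← mul_assoc, div_mul_cancel₀ _ hs's]
      linarith
    · rw [show X 1 - L' 1 = (s' - s) * (L 1 - A 1) by linarith, ← mul_assoc, div_mul_cancel₀ _ hs's]
      linarith
  have w0 : K 0 - L' 0 = (1 - j) * (T 0 - L' 0) := by linarith
  have w1 : K 1 - L' 1 = (1 - j) * (T 1 - L' 1) := by linarith
  have hdet : (X 0 - L' 0) * (T 1 - L' 1) - (X 1 - L' 1) * (T 0 - L' 0) ≠ 0 := by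
    intro h
    apply hTn
    have e0 : X 0 - L' 0 = (s' - s) * (L 0 - A 0) := by linarith
    have e1 : X 1 - L' 1 = (s' - s) * (L 1 - A 1) := by linarith
    rw [e0, e1] at h
    have h' : (L 0 - A 0) * (T 1 - A 1) - (L 1 - A 1) * (T 0 - A 0) = 0 := by
      apply mul_left_cancel₀ hs's
      linear_combination h + (s' - s) * (L 0 - A 0) * y1 - (s' - s) * (L 1 - A 1) * y0
    apply aux_mem' T A L (((T 0 - A 0) * (L 0 - A 0) + (T 1 - A 1) * (L 1 - A 1)) / n)
    · field_simp
      rw [hn]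
      linear_combination -(L 1 - A 1) * h'
    · field_simp
      rw [hn]
      linear_combination (L 0 - A 0) * h'
  obtain ⟨H, hH⟩ : ∃ H, H = 2 * ((L 0 - L' 0) * (O 0 - L' 0) + (L 1 - L' 1) * (O 1 - L' 1)) := ⟨_, rfl⟩
  obtain ⟨nx, hnx⟩ : ∃ z, z = (X 0 - L' 0)^2 + (X 1 - L' 1)^2 := ⟨_, rfl⟩
  obtain ⟨nt, hnt⟩ : ∃ z, z = (T 0 - L' 0)^2 + (T 1 - L' 1)^2 := ⟨_, rfl⟩
  have px : p * nx = H := by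
    rw [hnx, hH, p0, p1]; linear_combination p * (dX - dL')
  have pt : (1 - j) * nt = H := by
    have : H = 2 * ((K 0 - L' 0) * (O 0 - L' 0) + (K 1 - L' 1) * (O 1 - L' 1)) := by
      rw [hH]; linear_combination -2 * hKL
    rw [this, hnt, w0, w1]; linear_combination (1 - j) * (dT - dL')
  obtain ⟨det, hdt⟩ : ∃ z, z = (X 0 - L' 0) * (T 1 - L' 1) - (X 1 - L' 1) * (T 0 - L' 0) := ⟨_, rfl⟩
  rw [← hdt] at hdet
  obtain ⟨z0, z1, ex, et⟩ : ∃ z0 z1 : ℝ,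
      2 * ((X 0 - L' 0) * z0 + (X 1 - L' 1) * z1) = nx + H ∧
      2 * ((T 0 - L' 0) * z0 + (T 1 - L' 1) * z1) = nt + H := by
    refine ⟨((nx + H) * (T 1 - L' 1) - (nt + H) * (X 1 - L' 1)) / (2 * det),
      ((nt + H) * (X 0 - L' 0) - (nx + H) * (T 0 - L' 0)) / (2 * det), ?_, ?_⟩
    · field_simp
      rw [hdt]; ring
    · field_simp
      rw [hdt]; ring
  refine ⟨⟨!₂[L' 0 + z0, L' 1 + z1], √(z0^2 + z1^2 - H), ?_⟩, ?_⟩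
  · have key : ∀ Y : Plane, (Y 0 - L' 0)^2 + (Y 1 - L' 1)^2
        - 2 * ((Y 0 - L' 0) * z0 + (Y 1 - L' 1) * z1) + H = 0 →
        dist Y !₂[L' 0 + z0, L' 1 + z1] = √(z0^2 + z1^2 - H) := by
      intro Y hY
      rw [EuclideanSpace.dist_eq]
      congr 1
      simp [Fin.sum_univ_two, Real.dist_eq, sq_abs]
      linear_combination hY
    intro Y hY
    rcases hY with rfl | rfl | rfl | rfl
    · apply key; linear_combination -hnx - ex
    · apply key; linear_combination -hnt - et
    · apply key; rw [p0, p1]; linear_combination -p^2 * hnx - p * ex + (p - 1) * px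
    · apply key; rw [w0, w1]
      linear_combination -(1-j)^2 * hnt - (1-j) * et + ((1-j) - 1) * pt
  · exact coplanar_of_finrank_eq_two _ (by simp)
end

section
/- We have ∠HIK = θ/4. -/
open EuclideanGeometry Real RealInnerProductSpace Affine

structure Fr where
  x : Plane → ℝ
  y : Plane → ℝ
  cx : ∀ (X Y Z : Plane) (α β γ : ℝ), α + β + γ = 1 → x (α • X + β • Y + γ • Z) = α * x X + β * x Y + γ * x Z
  cy : ∀ (X Y Z : Plane) (α β γ : ℝ), α + β + γ = 1 → y (α • X + β • Y + γ • Z) = α * y X + β * y Y + γ * y Z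
  inn : ∀ X Y Z W : Plane, inner ℝ (X - Y) (Z - W) = (x X - x Y) * (x Z - x W) + (y X - y Y) * (y Z - y W)

def mkFr (B : Plane) (c s e : ℝ) (h : c ^ 2 + s ^ 2 = 1) (he : e ^ 2 = 1) : Fr where
  x X := c * (X 0 - B 0) + s * (X 1 - B 1)
  y X := e * (- s * (X 0 - B 0) + c * (X 1 - B 1))
  cx X Y Z α β γ hs := by
    have : α = 1 - β - γ := by linarith
    subst this
    simp; ring
  cy X Y Z α β γ hs := by
    have : α = 1 - β - γ := by linarith
    subst this
    simp; ring
  inn X Y Z W := by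
    have : ∀ P Q : Plane, inner ℝ P Q = P 0 * Q 0 + P 1 * Q 1 := by
      intro P Q
      simp [PiLp.inner_apply, Fin.sum_univ_two]; ring
    rw [this]
    simp only [PiLp.sub_apply]
    linear_combination (-(X 0 - Y 0) * (Z 0 - W 0) - (X 1 - Y 1) * (Z 1 - W 1)) * h - (-s * (X 0 - Y 0) + c * (X 1 - Y 1)) * (-s * (Z 0 - W 0) + c * (Z 1 - W 1)) * he

lemma Fr.dist_sq (F : Fr) (X Y : Plane) : dist X Y ^ 2 = (F.x X - F.x Y) ^ 2 + (F.y X - F.y Y) ^ 2 := by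
  rw [dist_eq_norm, ← real_inner_self_eq_norm_sq, F.inn]; ring

lemma Fr.line (F : Fr) {A C P : Plane} (h : P ∈ affineSpan ℝ ({A, C} : Set Plane)) :
    ∃ t : ℝ, F.x P = F.x A + t * (F.x C - F.x A) ∧ F.y P = F.y A + t * (F.y C - F.y A) := by
  obtain ⟨t, rfl⟩ := mem_affineSpan_pair_iff_exists_lineMap_eq.1 h
  refine ⟨t, ?_, ?_⟩
  · have := F.cx A C C (1 - t) t 0 (by ring)
    rw [zero_smul, add_zero] at this
    rw [AffineMap.lineMap_apply_module, this]; ring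
  · have := F.cy A C C (1 - t) t 0 (by ring)
    rw [zero_smul, add_zero] at this
    rw [AffineMap.lineMap_apply_module, this]; ring

lemma Fr.hull (F : Fr) {A B C P : Plane} (h : P ∈ convexHull ℝ ({A, B, C} : Set Plane)) :
    ∃ α β γ : ℝ, 0 ≤ α ∧ 0 ≤ β ∧ 0 ≤ γ ∧ α + β + γ = 1 ∧
      F.x P = α * F.x A + β * F.x B + γ * F.x C ∧ F.y P = α * F.y A + β * F.y B + γ * F.y C := by
  rw [convexHull_insert (by simp)] at h
  simp only [convexHull_pair, convexJoin_singleton_left, Set.mem_iUnion] at h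
  obtain ⟨Q, ⟨u, v, hu, hv, huv, rfl⟩, ⟨u', v', hu', hv', huv', rfl⟩⟩ := h
  have e : u' • A + v' • (u • B + v • C) = u' • A + (v' * u) • B + (v' * v) • C := by
    rw [smul_add, smul_smul, smul_smul, add_assoc]
  have hs : u' + v' * u + v' * v = 1 := by rw [← huv']; linear_combination v' * huv
  refine ⟨u', v' * u, v' * v, hu', by positivity, by positivity, hs, ?_, ?_⟩
  · rw [e, F.cx _ _ _ _ _ _ hs]
  · rw [e, F.cy _ _ _ _ _ _ hs]

lemma Fr.infd (F : Fr) {A C P : Plane} {r : ℝ}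
    (h : Metric.infDist P (affineSpan ℝ ({A, C} : Set Plane) : Set Plane) = r) :
    ((F.x C - F.x A) * (F.y P - F.y A) - (F.y C - F.y A) * (F.x P - F.x A)) ^ 2
      = r ^ 2 * ((F.x C - F.x A) ^ 2 + (F.y C - F.y A) ^ 2) := by
  have hne : (affineSpan ℝ ({A, C} : Set Plane) : Set Plane).Nonempty := ⟨A, left_mem_affineSpan_pair ℝ A C⟩
  have : Nonempty (affineSpan ℝ ({A, C} : Set Plane)) := hne.to_subtype
  have h1 := EuclideanGeometry.dist_orthogonalProjection_eq_infDist (affineSpan ℝ ({A, C} : Set Plane)) P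
  set Q := EuclideanGeometry.orthogonalProjection (affineSpan ℝ ({A, C} : Set Plane)) P with hQ
  have h2 : inner ℝ (C - A) (P - (Q : Plane)) = 0 := by
    have := EuclideanGeometry.vsub_orthogonalProjection_mem_direction_orthogonal (affineSpan ℝ ({A, C} : Set Plane)) P
    exact (Submodule.mem_orthogonal _ _).1 this (C - A) (AffineSubspace.vsub_mem_direction (right_mem_affineSpan_pair ℝ A C) (left_mem_affineSpan_pair ℝ A C))
  obtain ⟨t, hx, hy⟩ := F.line Q.2
  rw [F.inn] at h2
  have h3 := F.dist_sq P Q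
  rw [h1, h] at h3
  rw [h3]
  rw [hx, hy] at h2 ⊢
  linear_combination (-((F.x C - F.x A) * (F.x P - (F.x A + t * (F.x C - F.x A))) +
      (F.y C - F.y A) * (F.y P - (F.y A + t * (F.y C - F.y A))))) * h2

lemma Fr.perp (F : Fr) {A C P H : Plane} {r : ℝ}
    (h : Metric.infDist P (affineSpan ℝ ({A, C} : Set Plane) : Set Plane) = r)
    (hH : H ∈ affineSpan ℝ ({A, C} : Set Plane)) (hd : dist P H = r) :
    (F.x C - F.x A) * (F.x P - F.x H) + (F.y C - F.y A) * (F.y P - F.y H) = 0 := by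
  have h1 := F.infd h
  obtain ⟨t, hx, hy⟩ := F.line hH
  have h2 := F.dist_sq P H
  rw [hd] at h2
  rw [h2] at h1
  rw [hx, hy] at h1 ⊢
  apply pow_eq_zero_iff (two_ne_zero) |>.1
  linear_combination -h1

lemma Fr.ypos (F : Fr) {A B C T : Plane} (hB : F.y B = 0) (hC : F.y C = 0) (hA : 0 < F.y A)
    (h : T ∈ interior (convexHull ℝ ({A, B, C} : Set Plane))) : 0 < F.y T := by
  have hc : Continuous (fun t : ℝ => AffineMap.lineMap A T t) := AffineMap.lineMap_continuous
  have hn : ∀ᶠ t in nhds (1:ℝ), AffineMap.lineMap A T t ∈ interior (convexHull ℝ ({A, B, C} : Set Plane)) := by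
    apply hc.continuousAt.eventually_mem
    apply isOpen_interior.mem_nhds
    simpa using h
  obtain ⟨t, ht, ht1⟩ := ((hn.filter_mono nhdsWithin_le_nhds).and (self_mem_nhdsWithin : Set.Ioi (1:ℝ) ∈ nhdsWithin 1 (Set.Ioi 1))).exists
  obtain ⟨α, β, γ, hα, hβ, hγ, hs, hx, hy⟩ := F.hull (interior_subset ht)
  have := F.cy A T T (1 - t) t 0 (by ring)
  rw [zero_smul, add_zero] at this
  rw [AffineMap.lineMap_apply_module, this, hB, hC] at hy
  have h5 : 0 ≤ α * F.y A := by positivity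
  have : 0 < t * F.y T := by nlinarith
  exact pos_of_mul_pos_right this (by linarith) |> fun h => h

lemma D_mem {S : Set Plane} (hS : Convex ℝ S) {D : Plane} {ρ : ℝ} (hρ : 0 < ρ) (h : Metric.sphere D ρ ⊆ S) : D ∈ S := by
  have h1 : D + EuclideanSpace.single 0 ρ ∈ S := h (by simp [hρ.le])
  have h2 : D - EuclideanSpace.single 0 ρ ∈ S := h (by simp [hρ.le])
  have := hS h1 h2 (by norm_num : (0:ℝ) ≤ 1/2) (by norm_num : (0:ℝ) ≤ 1/2) (by norm_num)
  convert this using 1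
  module

lemma exists_fr {A B C : Plane} (hABC : AffineIndependent ℝ ![A, B, C]) :
    ∃ F : Fr, F.x B = 0 ∧ F.y B = 0 ∧ F.y C = 0 ∧ 0 < F.x C ∧ 0 < F.y A := by
  have hBC : B ≠ C := by
    intro h
    have := hABC.injective (a₁ := 1) (a₂ := 2) (by simpa using h)
    simp at this
  have hd : 0 < (C 0 - B 0) ^ 2 + (C 1 - B 1) ^ 2 := by
    by_contra hcon
    apply hBC
    have h0 : C 0 - B 0 = 0 := by nlinarith [sq_nonneg (C 0 - B 0), sq_nonneg (C 1 - B 1)]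
    have h1 : C 1 - B 1 = 0 := by nlinarith [sq_nonneg (C 0 - B 0), sq_nonneg (C 1 - B 1)]
    ext i; fin_cases i
    · simp; linarith
    · simp; linarith
  have hcr : (C 0 - B 0) * (A 1 - B 1) - (C 1 - B 1) * (A 0 - B 0) ≠ 0 := by
    intro h
    rw [affineIndependent_iff_not_collinear_set] at hABC
    apply hABC
    rw [Set.insert_comm, collinear_iff_of_mem (p₀ := B) (by simp)]
    refine ⟨C - B, ?_⟩
    simp only [Set.mem_insert_iff, Set.mem_singleton_iff, forall_eq_or_imp, forall_eq]
    refine ⟨⟨0, by simp⟩, ⟨((C 0 - B 0) * (A 0 - B 0) + (C 1 - B 1) * (A 1 - B 1)) / ((C 0 - B 0) ^ 2 + (C 1 - B 1) ^ 2), ?_⟩, ⟨1, by simp⟩⟩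
    ext i; fin_cases i
    · simp; field_simp; linear_combination (-(C 1 - B 1)) * h
    · simp; field_simp; linear_combination ((C 0 - B 0)) * h
  set a := √((C 0 - B 0) ^ 2 + (C 1 - B 1) ^ 2) with ha
  have ha2 : a ^ 2 = (C 0 - B 0) ^ 2 + (C 1 - B 1) ^ 2 := Real.sq_sqrt hd.le
  have hap : 0 < a := Real.sqrt_pos.2 hd
  have h1 : ((C 0 - B 0) / a) ^ 2 + ((C 1 - B 1) / a) ^ 2 = 1 := by
    field_simp; linarith
  have key : ∀ e : ℝ, e ^ 2 = 1 → 0 < e * ((C 0 - B 0) * (A 1 - B 1) - (C 1 - B 1) * (A 0 - B 0)) → 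
      ∃ F : Fr, F.x B = 0 ∧ F.y B = 0 ∧ F.y C = 0 ∧ 0 < F.x C ∧ 0 < F.y A := by
    intro e he hp
    refine ⟨mkFr B ((C 0 - B 0) / a) ((C 1 - B 1) / a) e h1 he, by simp [mkFr], by simp [mkFr], ?_, ?_, ?_⟩
    · simp only [mkFr]; ring
    · simp only [mkFr]
      have : (C 0 - B 0) / a * (C 0 - B 0) + (C 1 - B 1) / a * (C 1 - B 1) = ((C 0 - B 0) ^ 2 + (C 1 - B 1) ^ 2) / a := by ring
      rw [this]; positivity
    · simp only [mkFr]
      have : e * (-((C 1 - B 1) / a) * (A 0 - B 0) + (C 0 - B 0) / a * (A 1 - B 1)) = e * ((C 0 - B 0) * (A 1 - B 1) - (C 1 - B 1) * (A 0 - B 0)) / a := by ring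
      rw [this]; positivity
  rcases lt_or_gt_of_ne hcr with h | h
  · exact key (-1) (by norm_num) (by linarith)
  · exact key 1 (by norm_num) (by linarith)

lemma core1 {a x1 y1 b c r α β γ xi yi : ℝ} (ha : 0 < a) (hy1 : 0 < y1) (hb : 0 < b) (hc : 0 < c)
    (hb2 : b ^ 2 = (x1 - a) ^ 2 + y1 ^ 2) (hc2 : c ^ 2 = x1 ^ 2 + y1 ^ 2) (hr : 0 < r)
    (hβ : 0 ≤ β) (hγ : 0 ≤ γ) (hs : α + β + γ = 1)
    (hx : xi = α * x1 + γ * a) (hy : yi = α * y1)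
    (h1 : ((0 - x1) * (yi - y1) - (0 - y1) * (xi - x1)) ^ 2 = r ^ 2 * ((0 - x1) ^ 2 + (0 - y1) ^ 2))
    (h2 : ((a - x1) * (yi - y1) - (0 - y1) * (xi - x1)) ^ 2 = r ^ 2 * ((a - x1) ^ 2 + (0 - y1) ^ 2)) :
    β * (a * y1) = r * b ∧ γ * (a * y1) = r * c := by
  have hα : α = 1 - β - γ := by linarith
  subst hα hx hy
  constructor
  · apply (pow_left_inj₀ (by positivity) (by positivity) two_ne_zero).1
    rw [mul_pow r, hb2]
    linear_combination h2
  · apply (pow_left_inj₀ (by positivity) (by positivity) two_ne_zero).1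
    rw [mul_pow r, hc2]
    linear_combination h1

/-- the algebraic heart -/
lemma core2 {a b c p q w s x1 y1 r ρ u xd yd k R : ℝ}
    (ha : a = p + q) (hb : b = q + w) (hc : c = p + w) (hs : s = p + q + w)
    (hp : 0 < p) (hq : 0 < q) (hw : 0 < w) (hr : 0 < r) (hρ : 0 < ρ) (hyd : 0 ≤ yd) (hR : 0 < R)
    (hb2 : b ^ 2 = (x1 - a) ^ 2 + y1 ^ 2) (hc2 : c ^ 2 = x1 ^ 2 + y1 ^ 2)
    (hy1 : a * y1 = 2 * r * s) (hρu : ρ = (1 - u) * r)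
    (hxd : xd = p + u * (x1 - p)) (hydu : yd = r + u * (y1 - r))
    (hRk : R ^ 2 = k ^ 2 + a ^ 2 / 4)
    (hE : (a / 2 - xd) ^ 2 + (k - yd) ^ 2 = (R + ρ) ^ 2) :
    2 * r * (k + R) = a * u * w ∧ r ^ 2 * s = p * q * w ∧ a * (x1 - p) = w * (p - q) := by
  have hap : 0 < a := by rw [ha]; positivity
  have hsp : 0 < s := by rw [hs]; positivity
  have hx : a * (x1 - p) = w * (p - q) := by
    subst ha hb hc
    linear_combination (hb2 - hc2) / 2
  have hrs : r ^ 2 * s = p * q * w := by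
    have hax : a * x1 = p * s - q * w := by
      rw [hs]; rw [ha] at hx ⊢; linear_combination hx
    have : 4 * s * (r ^ 2 * s) = 4 * s * (p * q * w) := by
      have e1 : (a * y1) ^ 2 = a ^ 2 * c ^ 2 - (a * x1) ^ 2 := by rw [hc2]; ring
      rw [hy1, hax] at e1
      rw [ha, hc, hs] at e1
      rw [hs]
      linear_combination e1
    exact mul_left_cancel₀ (by positivity) this
  refine ⟨?_, hrs, hx⟩
  have hP1 : a ^ 2 * ((x1 - p) ^ 2 + (y1 - r) ^ 2 - r ^ 2) = a ^ 2 * w ^ 2 := by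
    have : a ^ 2 * ((x1 - p) ^ 2 + (y1 - r) ^ 2 - r ^ 2) = (a * (x1 - p)) ^ 2 + (a * y1) ^ 2 - 2 * r * a * (a * y1) := by ring
    rw [this, hx, hy1]
    subst ha hs
    linear_combination 4 * w * hrs
  have hP1' := mul_left_cancel₀ (by positivity : a ^ 2 ≠ 0) hP1
  have hP2 : a * ((p - q) * (x1 - p) + 2 * r * y1) = a * (a * w) := by
    have : a * ((p - q) * (x1 - p) + 2 * r * y1) = (p - q) * (a * (x1 - p)) + 2 * r * (a * y1) := by ring
    rw [this, hx, hy1]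
    subst ha
    linear_combination 4 * hrs
  have hP2' := mul_left_cancel₀ hap.ne' hP2
  have hP : xd ^ 2 - a * xd + yd ^ 2 - ρ ^ 2 = a * u * w + u ^ 2 * w ^ 2 - p * q := by
    subst hxd hydu hρu ha
    linear_combination u * hP2' + u ^ 2 * hP1'
  have hE2 : 2 * (k * yd + R * ρ) = a * u * w + u ^ 2 * w ^ 2 - p * q := by
    rw [← hP]; linear_combination -hE - hRk
  have hm : 0 < k + R := by
    have : |k| < R := abs_lt_of_sq_lt_sq (by nlinarith) hR.le
    have := (abs_lt.1 this).1
    linarith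
  have hfac : (2 * r * (k + R) - a * u * w) * ((yd + ρ) * (k + R) + p * q) = 0 := by
    have hyr : yd - ρ = u * y1 := by rw [hydu, hρu]; ring
    have hyr2 : a * (yd + ρ) = 2 * r * a + 2 * u * r * w := by
      rw [hydu, hρu]; 
      rw [hs] at hy1
      rw [ha] at hy1 ⊢
      linear_combination u * hy1
    have hmn : (k + R) * (R - k) = a ^ 2 / 4 := by linear_combination hRk
    linear_combination 2 * r * (k + R) * hE2 + 2 * r * (yd - ρ) * hmn + r * a ^ 2 / 2 * hyr + r * a * u / 2 * hy1 + a * u * hrs - (k + R) * u * w * hyr2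
  rcases mul_eq_zero.1 hfac with h | h
  · linarith
  · exfalso
    have : 0 < (yd + ρ) * (k + R) + p * q := by positivity
    linarith

lemma angle_lem {r w u k R a cφ cτ φ τ : ℝ} (hr : 0 < r) (ha : 0 < a) (hR : 0 < R)
    (hRk : R ^ 2 = k ^ 2 + a ^ 2 / 4) (hk : 2 * r * (k + R) = a * u * w)
    (hφ0 : 0 ≤ φ) (hφ1 : φ ≤ π) (hτ0 : 0 ≤ τ) (hτ1 : τ ≤ π)
    (hcφ : cos φ = cφ) (hcτ : cos τ = cτ) (h0 : 0 ≤ cφ)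
    (h1 : cφ ^ 2 * (r ^ 2 + u ^ 2 * w ^ 2) = r ^ 2) (h2 : cτ * R = k) :
    φ = (2 * (π - τ)) / 4 := by
  have hφ : φ ≤ π / 2 := by
    by_contra h
    push Not at h
    have := Real.cos_neg_of_pi_div_two_lt_of_lt h (by linarith [Real.pi_pos])
    linarith
  have : τ = π - 2 * φ := by
    apply Real.injOn_cos ⟨hτ0, hτ1⟩ ⟨by linarith, by linarith⟩
    rw [Real.cos_pi_sub, Real.cos_two_mul, hcφ, hcτ]
    have e : r ^ 2 + u ^ 2 * w ^ 2 ≠ 0 := by positivity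
    have hc2 : cφ ^ 2 = r ^ 2 / (r ^ 2 + u ^ 2 * w ^ 2) := by field_simp; linarith
    have hc1 : cτ = k / R := by field_simp; linarith
    rw [hc2, hc1]
    field_simp
    have : a ^ 2 * (k * (r ^ 2 + u ^ 2 * w ^ 2)) = a ^ 2 * (R * (r ^ 2 + u ^ 2 * w ^ 2 - 2 * r ^ 2)) := by
      have : (a * u * w) ^ 2 = (2 * r * (k + R)) ^ 2 := by rw [hk]
      linear_combination (k - R) * this + 4 * r ^ 2 * (-k - R) * hRk
    have := mul_left_cancel₀ (by positivity) this
    linarith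
  linarith

lemma sides {a b c x1 y1 : ℝ} (ha : 0 < a) (hyA : 0 < y1) (hb : 0 < b) (hc : 0 < c)
    (hb2 : b ^ 2 = (x1 - a) ^ 2 + y1 ^ 2) (hc2 : c ^ 2 = x1 ^ 2 + y1 ^ 2) :
    0 < (b + c - a) / 2 ∧ 0 < (a + c - b) / 2 ∧ 0 < (a + b - c) / 2 := by
  have hcx : |x1| < c := abs_lt_of_sq_lt_sq (by nlinarith) hc.le
  have hbx : |x1 - a| < b := abs_lt_of_sq_lt_sq (by nlinarith) hb.le
  obtain ⟨hcx1, hcx2⟩ := abs_lt.1 hcx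
  obtain ⟨hbx1, hbx2⟩ := abs_lt.1 hbx
  have hw : 0 < (b + c - a) / 2 := by linarith
  have hp : 0 < (a + c - b) / 2 := by
    have : b < a + c := lt_of_pow_lt_pow_left₀ 2 (by positivity) (by nlinarith)
    linarith
  have hq : 0 < (a + b - c) / 2 := by
    have : c < a + b := lt_of_pow_lt_pow_left₀ 2 (by positivity) (by nlinarith)
    linarith
  exact ⟨hw, hp, hq⟩

set_option maxHeartbeats 400000 in
theorem angle_HIK_eq_theta_div_four
    (A B C I Oω D T : Plane) (r Rω ρ : ℝ)
    (hABC : AffineIndependent ℝ ![A, B, C])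
    (hr : 0 < r)
    (hIin : I ∈ interior (convexHull ℝ ({A, B, C} : Set Plane)))
    (hIab : Metric.infDist I (affineSpan ℝ ({A, B} : Set Plane) : Set Plane) = r)
    (hIbc : Metric.infDist I (affineSpan ℝ ({B, C} : Set Plane) : Set Plane) = r)
    (hIca : Metric.infDist I (affineSpan ℝ ({C, A} : Set Plane) : Set Plane) = r)
    (hRω : 0 < Rω) (hρ : 0 < ρ)
    (hBω : dist B Oω = Rω) (hCω : dist C Oω = Rω)
    (hγin : Metric.sphere D ρ ⊆ convexHull ℝ ({A, B, C} : Set Plane))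
    (hγAB : Metric.infDist D (affineSpan ℝ ({A, B} : Set Plane) : Set Plane) = ρ)
    (hγAC : Metric.infDist D (affineSpan ℝ ({A, C} : Set Plane) : Set Plane) = ρ)
    (hext : dist Oω D = Rω + ρ)
    (hTω : dist T Oω = Rω) (hTγ : dist T D = ρ)
    (hTseg : Wbtw ℝ Oω T D)
    (hTin : T ∈ interior (convexHull ℝ ({A, B, C} : Set Plane)))
    (H K : Plane)
    (hH : H ∈ affineSpan ℝ ({A, C} : Set Plane)) (hHI : dist I H = r)
    (hK : K ∈ affineSpan ℝ ({A, C} : Set Plane)) (hKγ : dist D K = ρ) :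
    ∠ H I K = (2 * (π - ∠ B T C)) / 4 := by
  obtain ⟨F, hxB, hyB, hyC, ha, hyA⟩ := exists_fr hABC
  have hIac : Metric.infDist I (affineSpan ℝ ({A, C} : Set Plane) : Set Plane) = r := by
    rw [Set.pair_comm]; exact hIca
  have hD := D_mem (convex_convexHull ℝ _) hρ hγin
  have hTy := F.ypos hyB hyC hyA hTin
  have hIy := F.ypos hyB hyC hyA hIin
  obtain ⟨α, β, γ, hα, hβ, hγ, hs, hIx1, hIy1⟩ := F.hull (interior_subset hIin)
  obtain ⟨α', β', γ', hα', hβ', hγ', hs', hDx1, hDy1⟩ := F.hull hD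
  have iab := F.infd hIab
  have ibc := F.infd hIbc
  have iac := F.infd hIac
  have dab := F.infd hγAB
  have dac := F.infd hγAC
  have pH := F.perp hIac hH hHI
  have pK := F.perp hγAC hK hKγ
  obtain ⟨tH, hHx, hHy⟩ := F.line hH
  obtain ⟨tK, hKx, hKy⟩ := F.line hK
  have dB := F.dist_sq B Oω
  have dC := F.dist_sq C Oω
  have dT := F.dist_sq T Oω
  have dO := F.dist_sq Oω D
  have dH := F.dist_sq I H
  rw [hBω] at dB
  rw [hCω] at dC
  rw [hTω] at dT
  rw [hext] at dO
  rw [hHI] at dH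
  have nB := F.dist_sq B T
  have nC := F.dist_sq C T
  have nK := F.dist_sq K I
  have iT := F.inn B T C T
  have iI := F.inn H I K I
  simp only [hxB, hyB, hyC] at *
  generalize F.x C = a at *
  generalize F.x A = x1 at *
  generalize F.y A = y1 at *
  generalize F.x I = xi at *
  generalize F.y I = yi at *
  generalize F.x D = xd at *
  generalize F.y D = yd at *
  generalize F.y Oω = k at *
  generalize F.x T = xt at *
  generalize F.y T = yt at *
  have hxo : F.x Oω = a / 2 := by
    have : a * (F.x Oω) = a * (a / 2) := by linear_combination (dC - dB) / 2
    exact mul_left_cancel₀ ha.ne' this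
  rw [hxo] at dB dC dT dO
  have hRk : Rω ^ 2 = k ^ 2 + a ^ 2 / 4 := by rw [dB]; ring
  obtain ⟨b, hb, hb2⟩ : ∃ b : ℝ, 0 < b ∧ b ^ 2 = (x1 - a) ^ 2 + y1 ^ 2 :=
    ⟨√((x1 - a) ^ 2 + y1 ^ 2), by positivity, Real.sq_sqrt (by positivity)⟩
  obtain ⟨c, hc, hc2⟩ : ∃ c : ℝ, 0 < c ∧ c ^ 2 = x1 ^ 2 + y1 ^ 2 :=
    ⟨√(x1 ^ 2 + y1 ^ 2), by positivity, Real.sq_sqrt (by positivity)⟩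
  have hyr : yi = r := by
    apply (pow_left_inj₀ hIy.le hr.le two_ne_zero).1
    have : a ^ 2 * yi ^ 2 = a ^ 2 * r ^ 2 := by linear_combination ibc
    exact mul_left_cancel₀ (by positivity) this
  have hIx2 : xi = α * x1 + γ * a := by linarith
  have hIy2 : yi = α * y1 := by linarith
  have hDx2 : xd = α' * x1 + γ' * a := by linarith
  have hDy2 : yd = α' * y1 := by linarith
  obtain ⟨hβe, hγe⟩ := core1 ha hyA hb hc hb2 hc2 hr hβ hγ hs hIx2 hIy2 iab iac
  obtain ⟨hβe', hγe'⟩ := core1 ha hyA hb hc hb2 hc2 hρ hβ' hγ' hs' hDx2 hDy2 dab dac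
  -- side inequalities
  obtain ⟨hw, hp, hq⟩ := sides ha hyA hb hc hb2 hc2
  have hay : a * y1 = 2 * r * ((a + b + c) / 2) := by
    have h1 : α * (a * y1) = r * a := by rw [← hyr, hIy2]; ring
    linear_combination -(a * y1) * hs + h1 + hβe + hγe
  have h2ax : 2 * a * x1 = a ^ 2 + c ^ 2 - b ^ 2 := by rw [hb2, hc2]; ring
  have hxp : xi = (a + c - b) / 2 := by
    have h1 : α * (a * y1) = r * a := by rw [← hyr, hIy2]; ring
    have : (a * y1) * xi = (a * y1) * ((a + c - b) / 2) := by
      rw [hIx2]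
      linear_combination x1 * h1 + a * hγe - ((a + c - b) / 2) * hay + r / 2 * h2ax
    exact mul_left_cancel₀ (by positivity) this
  obtain ⟨u, hu⟩ : ∃ u : ℝ, ρ = (1 - u) * r := ⟨1 - ρ / r, by field_simp; ring⟩
  have hβu : β' = (1 - u) * β := by
    have : (a * y1) * β' = (a * y1) * ((1 - u) * β) := by
      linear_combination hβe' - (1 - u) * hβe + b * hu
    exact mul_left_cancel₀ (by positivity) this
  have hγu : γ' = (1 - u) * γ := by
    have : (a * y1) * γ' = (a * y1) * ((1 - u) * γ) := by
      linear_combination hγe' - (1 - u) * hγe + c * hu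
    exact mul_left_cancel₀ (by positivity) this
  have hxd : xd = xi + u * (x1 - xi) := by
    have e1 : α = 1 - β - γ := by linarith
    have e2 : α' = 1 - β' - γ' := by linarith
    rw [hDx2, hIx2, e1, e2, hβu, hγu]; ring
  have hyd : yd = yi + u * (y1 - yi) := by
    have e1 : α = 1 - β - γ := by linarith
    have e2 : α' = 1 - β' - γ' := by linarith
    rw [hDy2, hIy2, e1, e2, hβu, hγu]; ring
  have hyd0 : 0 ≤ yd := by rw [hDy2]; positivity
  obtain ⟨hk, hrs, hxx⟩ := core2 (a := a) (b := b) (c := c) (p := (a + c - b) / 2) (q := (a + b - c) / 2)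
    (w := (b + c - a) / 2) (s := (a + b + c) / 2) (by ring) (by ring) (by ring) (by ring) hp hq hw hr hρ hyd0 hRω
    hb2 hc2 hay hu (by rw [hxd, hxp]) (by rw [hyd, hyr]) hRk dO.symm
  set w := (b + c - a) / 2 with hwdef
  -- K
  have hAI : (a - x1) * (xi - x1) + (0 - y1) * (yi - y1) = b * w := by
    have : a * ((a - x1) * (xi - x1) + (0 - y1) * (yi - y1)) = a * (b * w) := by
      have hax : a * x1 = (a ^ 2 + c ^ 2 - b ^ 2) / 2 := by linarith
      have e1 : a * ((a - x1) * (xi - x1) + (0 - y1) * (yi - y1))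
          = a ^ 2 * xi - (a + xi) * (a * x1) + a * (x1 ^ 2 + y1 ^ 2) - yi * (a * y1) := by ring
      rw [e1, ← hc2, hax, hay, hyr, hxp, hwdef]
      rw [hwdef] at hrs
      linear_combination -2 * hrs
    exact mul_left_cancel₀ ha.ne' this
  have hKI : dist K I ^ 2 = r ^ 2 + u ^ 2 * w ^ 2 := by
    have e1 : (a - x1) * (F.x K - xi) + (0 - y1) * (F.y K - yi) = -u * (b * w) := by
      rw [← hAI]
      rw [hxd, hyd] at pK
      linear_combination -pK
    have e2 : ((a - x1) * (F.y K - yi) - (0 - y1) * (F.x K - xi)) ^ 2 = r ^ 2 * b ^ 2 := by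
      rw [hb2, hKx, hKy]
      linear_combination iac
    have : b ^ 2 * dist K I ^ 2 = b ^ 2 * (r ^ 2 + u ^ 2 * w ^ 2) := by
      have e3 : ((a - x1) * (F.x K - xi) + (0 - y1) * (F.y K - yi)) ^ 2 = (-u * (b * w)) ^ 2 := by rw [e1]
      rw [nK]
      linear_combination e2 + e3 + ((F.x K - xi) ^ 2 + (F.y K - yi) ^ 2) * hb2
    exact mul_left_cancel₀ (by positivity) this
  have hKIp : 0 < dist K I := by
    have : 0 < dist K I ^ 2 := by rw [hKI]; positivity
    exact lt_of_le_of_ne dist_nonneg (fun h => by rw [← h] at this; norm_num at this)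
  have hdot : inner ℝ (H - I) (K - I) = r ^ 2 := by
    rw [iI, dH, hKx, hKy]
    rw [hHx, hHy] at pH ⊢
    linear_combination (tH - tK) * pH
  have hdotT : inner ℝ (B - T) (C - T) = 2 * k * yt := by
    rw [iT]; linear_combination hRk - dT
  have hBT : dist B T * dist C T = 2 * Rω * yt := by
    apply (pow_left_inj₀ (by positivity) (by positivity) two_ne_zero).1
    have e1 : ((0 - xt) * (a - xt) + (0 - yt) * (0 - yt)) ^ 2 = (2 * k * yt) ^ 2 := by rw [← iT, hdotT]
    rw [mul_pow, nB, nC]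
    linear_combination e1 - 4 * yt ^ 2 * hRk
  refine angle_lem (cφ := r / dist K I) (cτ := k / Rω) hr ha hRω hRk hk (EuclideanGeometry.angle_nonneg _ _ _)
    (EuclideanGeometry.angle_le_pi _ _ _) (EuclideanGeometry.angle_nonneg _ _ _)
    (EuclideanGeometry.angle_le_pi _ _ _) ?_ ?_ (by positivity) ?_ ?_
  · rw [EuclideanGeometry.angle, InnerProductGeometry.cos_angle]
    simp only [vsub_eq_sub]
    rw [hdot, ← dist_eq_norm, ← dist_eq_norm, dist_comm H I, hHI]
    field_simp
  · rw [EuclideanGeometry.angle, InnerProductGeometry.cos_angle]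
    simp only [vsub_eq_sub]
    rw [hdotT, ← dist_eq_norm, ← dist_eq_norm, hBT]
    field_simp
  · rw [← hKI]; field_simp
  · field_simp
end

section
/- We have ρ_a + ρ_b + ρ_c = 3r − r·t·(4R + r)/p, where t = tan(θ/4). -/
open EuclideanGeometry Real RealInnerProductSpace Affine

lemma tr_dist_sq (P Q : Plane) : dist P Q ^ 2 = (P 0 - Q 0) ^ 2 + (P 1 - Q 1) ^ 2 := by
  rw [EuclideanSpace.dist_eq, Real.sq_sqrt (by positivity)]
  simp [Fin.sum_univ_two, Real.dist_eq, sq_abs]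

structure TrFrame (X Y : Plane → ℝ) : Prop where
  dsq : ∀ P Q, dist P Q ^ 2 = (X P - X Q) ^ 2 + (Y P - Y Q) ^ 2
  ax : ∀ (P Q : Plane) (s : ℝ), X (AffineMap.lineMap P Q s) = X P + s * (X Q - X P)
  ay : ∀ (P Q : Plane) (s : ℝ), Y (AffineMap.lineMap P Q s) = Y P + s * (Y Q - Y P)
  sh : ∀ (P : Plane) (s : ℝ), ∃ Q, X Q = X P ∧ Y Q = Y P + s

lemma tr_frame (A B C : Plane) (h : AffineIndependent ℝ ![A, B, C]) :
    ∃ X Y : Plane → ℝ, TrFrame X Y ∧ X B = 0 ∧ Y B = 0 ∧ X C = dist B C ∧ Y C = 0 ∧ 0 < Y A ∧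
      0 < dist B C := by
  have hBC : B ≠ C := by
    intro e
    have := h.injective.ne (show (1 : Fin 3) ≠ 2 by decide)
    simp [e] at this
  have ha : 0 < dist B C := dist_pos.mpr hBC
  obtain ⟨a, hade⟩ : ∃ a, a = dist B C := ⟨_, rfl⟩
  rw [← hade] at ha ⊢
  have hsq : a ^ 2 = (B 0 - C 0) ^ 2 + (B 1 - C 1) ^ 2 := by rw [hade]; exact tr_dist_sq B C
  have hcr : (C 0 - B 0) * (A 1 - B 1) - (C 1 - B 1) * (A 0 - B 0) ≠ 0 := by
    intro e
    rw [affineIndependent_iff_not_collinear_set] at h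
    apply h
    rw [collinear_iff_of_mem (p₀ := B) (by simp)]
    refine ⟨C - B, ?_⟩
    intro p hp
    simp only [Set.mem_insert_iff, Set.mem_singleton_iff] at hp
    rcases hp with rfl | rfl | rfl
    · refine ⟨((C 0 - B 0) * (p 0 - B 0) + (C 1 - B 1) * (p 1 - B 1)) / a ^ 2, ?_⟩
      ext i
      fin_cases i
      · simp
        field_simp
        rw [hsq]
        linear_combination (B 1 - C 1) * e
      · simp
        field_simp
        rw [hsq]
        linear_combination (C 0 - B 0) * e
    · exact ⟨0, by simp⟩
    · exact ⟨1, by simp⟩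
  obtain ⟨σ, hσ, hpos⟩ : ∃ σ : ℝ, σ ^ 2 = 1 ∧
      0 < σ * ((C 0 - B 0) * (A 1 - B 1) - (C 1 - B 1) * (A 0 - B 0)) := by
    rcases lt_or_gt_of_ne hcr with h | h
    · exact ⟨-1, by norm_num, by linarith⟩
    · exact ⟨1, by norm_num, by linarith⟩
  refine ⟨fun P => ((C 0 - B 0) * (P 0 - B 0) + (C 1 - B 1) * (P 1 - B 1)) / a,
    fun P => σ * ((C 0 - B 0) * (P 1 - B 1) - (C 1 - B 1) * (P 0 - B 0)) / a,
    ⟨?_, ?_, ?_, ?_⟩, ?_, ?_, ?_, ?_, ?_, ha⟩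
  · intro P Q
    rw [tr_dist_sq]
    field_simp
    rw [hsq]
    linear_combination (-((C 0 - B 0) * (P 1 - Q 1) - (C 1 - B 1) * (P 0 - Q 0)) ^ 2) * hσ
  · intro P Q s
    simp [AffineMap.lineMap_apply]
    field_simp
    ring
  · intro P Q s
    simp [AffineMap.lineMap_apply]
    field_simp
    ring
  · intro P s
    refine ⟨!₂[P 0 - s * σ * (C 1 - B 1) / a, P 1 + s * σ * (C 0 - B 0) / a], ?_, ?_⟩
    · simp
      field_simp
      ring
    · simp
      field_simp
      linear_combination (s * ((C 0 - B 0) ^ 2 + (C 1 - B 1) ^ 2)) * hσ - s * hsq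
  · simp
  · simp
  · field_simp
    rw [hsq]; ring
  · simp; left; right; ring
  · positivity

lemma tr_infDist {X Y : Plane → ℝ} (F : TrFrame X Y) (P Q D : Plane) (ρ : ℝ) (hPQ : 0 < dist P Q)
    (h : Metric.infDist D (affineSpan ℝ ({P, Q} : Set Plane) : Set Plane) = ρ) :
    ((X Q - X P) * (Y D - Y P) - (Y Q - Y P) * (X D - X P)) ^ 2 = (ρ * dist P Q) ^ 2 := by
  obtain ⟨c, hc⟩ : ∃ c, c = dist P Q := ⟨_, rfl⟩
  have hs : c ^ 2 = (X P - X Q) ^ 2 + (Y P - Y Q) ^ 2 := by rw [hc]; exact F.dsq P Q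
  rw [← hc] at hPQ ⊢
  let s : ℝ := ((X Q - X P) * (X D - X P) + (Y Q - Y P) * (Y D - Y P)) / c ^ 2
  let G : Plane := AffineMap.lineMap P Q s
  have hsc : s * c ^ 2 = (X Q - X P) * (X D - X P) + (Y Q - Y P) * (Y D - Y P) := by
    simp only [s]; field_simp
  have hG : G ∈ (affineSpan ℝ ({P, Q} : Set Plane) : Set Plane) :=
    AffineMap.lineMap_mem_affineSpan_pair s P Q
  have key : ∀ u : ℝ, c ^ 2 * dist D (AffineMap.lineMap P Q u) ^ 2 =
      ((X Q - X P) * (Y D - Y P) - (Y Q - Y P) * (X D - X P)) ^ 2 + (c ^ 2) ^ 2 * (u - s) ^ 2 := by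
    intro u
    rw [F.dsq, F.ax, F.ay]
    have : (c ^ 2) ^ 2 * (u - s) ^ 2 = (c ^ 2 * u - s * c ^ 2) ^ 2 := by ring
    rw [this, hsc, hs]
    ring
  have hmin : Metric.infDist D (affineSpan ℝ ({P, Q} : Set Plane) : Set Plane) = dist D G := by
    apply le_antisymm (Metric.infDist_le_dist_of_mem hG)
    rw [Metric.le_infDist ⟨G, hG⟩]
    intro y hy
    obtain ⟨u, rfl⟩ := _root_.mem_affineSpan_pair_iff_exists_lineMap_eq.1 hy
    have h1 := key u
    have h2 := key s
    refine (sq_le_sq₀ dist_nonneg dist_nonneg).1 ?_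
    have : 0 ≤ (c ^ 2) ^ 2 * (u - s) ^ 2 := by positivity
    have hc2 : 0 < c ^ 2 := by positivity
    have h3 : c ^ 2 * dist D G ^ 2 ≤ c ^ 2 * dist D (AffineMap.lineMap P Q u) ^ 2 := by
      rw [h1]; rw [h2]; simp; exact this
    exact le_of_mul_le_mul_left h3 hc2
  rw [hmin] at h
  have := key s
  rw [← h, mul_pow, mul_comm (dist D G ^ 2)]
  rw [show dist D G = dist D (AffineMap.lineMap P Q s) from rfl, this]; ring

lemma tr_half {X Y : Plane → ℝ} (F : TrFrame X Y) (A B C : Plane) (l m n : ℝ)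
    (hA : 0 ≤ l * X A + m * Y A + n) (hB : 0 ≤ l * X B + m * Y B + n)
    (hC : 0 ≤ l * X C + m * Y C + n) (P : Plane)
    (hP : P ∈ convexHull ℝ ({A, B, C} : Set Plane)) : 0 ≤ l * X P + m * Y P + n := by
  have hconv : Convex ℝ {P : Plane | 0 ≤ l * X P + m * Y P + n} := by
    intro x hx y hy a b ha hb hab
    have e : a • x + b • y = AffineMap.lineMap x y b := by
      rw [AffineMap.lineMap_apply_module, ← hab]; simp
    simp only [Set.mem_ofPred_eq] at hx hy ⊢
    rw [e, F.ax, F.ay]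
    have ha' : a = 1 - b := by linarith
    subst ha'
    nlinarith [mul_nonneg ha hx, mul_nonneg hb hy]
  have := convexHull_min (s := ({A, B, C} : Set Plane)) (by
    intro p hp
    simp only [Set.mem_insert_iff, Set.mem_singleton_iff] at hp
    rcases hp with rfl | rfl | rfl <;> assumption) hconv
  exact this hP

lemma tr_center (S : Set Plane) (hS : Convex ℝ S) (D : Plane) (ρ : ℝ) (hρ : 0 < ρ)
    (h : Metric.sphere D ρ ⊆ S) : D ∈ S := by
  let v : Plane := EuclideanSpace.single 0 ρ
  have hv : ‖v‖ = ρ := by simp [v, abs_of_pos hρ]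
  have h1 : D + v ∈ S := h (by simp [hv])
  have h2 : D - v ∈ S := h (by simp [hv])
  have := hS h1 h2 (a := 1/2) (b := 1/2) (by norm_num) (by norm_num) (by norm_num)
  convert this using 1
  module

lemma tr_alg (v w r t k xA yA xD yD h Ra u : ℝ) (hv : 0 < v) (hw : 0 < w) (hr : 0 < r)
    (ht : 0 < t) (hu : 0 < u) (huv : r ^ 2 * (u + v + w) = u * v * w)
    (hxA : xA * (v + w) = (v + w) * v + u * (v - w)) 
    (hyA : yA * (v + w) = 2 * r * (u + v + w))
    (hxD : xD = xA + k * (v - xA)) (hyD : yD = yA + k * (r - yA))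
    (hh : h = (v + w) * (t - 1 / t) / 4) (hRa : Ra = (v + w) * (t + 1 / t) / 4)
    (hk1 : k ≤ 1)
    (htan : (xD - (v + w) / 2) ^ 2 + (yD - h) ^ 2 = (Ra + k * r) ^ 2) :
    k = 1 - t * (r / u) := by
  have hvw : 0 < v * w - r ^ 2 := by
    have : u * (v * w - r ^ 2) = r ^ 2 * (v + w) := by linarith
    have h2 : 0 < u * (v * w - r ^ 2) := by rw [this]; positivity
    exact pos_of_mul_pos_right h2 hu.le
  have hue : u = r ^ 2 * (v + w) / (v * w - r ^ 2) := by
    field_simp; linarith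
  have hxA' : xA = v + u * (v - w) / (v + w) := by field_simp; linarith
  have hyA' : yA = 2 * r * (u + v + w) / (v + w) := by field_simp; linarith
  have fac : u ^ 2 * (k - (1 - t * (r / u))) * (k - (1 + (v * w + r * (v + w) * t) / (u * t * r)))
      = (xD - (v + w) / 2) ^ 2 + (yD - h) ^ 2 - (Ra + k * r) ^ 2 := by
    rw [hxD, hyD, hh, hRa, hxA', hyA', hue]
    have := hvw.ne'
    field_simp
    ring
  rw [htan, sub_self] at fac
  have hpos : 0 < (v * w + r * (v + w) * t) / (u * t * r) := by positivity
  rcases mul_eq_zero.1 fac with h1 | h1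
  · rcases mul_eq_zero.1 h1 with h2 | h2
    · exact absurd h2 (by positivity)
    · linarith
  · linarith

set_option maxHeartbeats 1600000 in
lemma tr_key (A B C I O Oa Da Ta : Plane) (r R θ t Ra ρ : ℝ)
    (hABC : AffineIndependent ℝ ![A, B, C])
    (hr : 0 < r)
    (hIin : I ∈ interior (convexHull ℝ ({A, B, C} : Set Plane)))
    (hIab : Metric.infDist I (affineSpan ℝ ({A, B} : Set Plane) : Set Plane) = r)
    (hIbc : Metric.infDist I (affineSpan ℝ ({B, C} : Set Plane) : Set Plane) = r)
    (hIca : Metric.infDist I (affineSpan ℝ ({C, A} : Set Plane) : Set Plane) = r)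
    (hR : 0 < R)
    (hOA : dist A O = R) (hOB : dist B O = R) (hOC : dist C O = R)
    (hθ0 : 0 < θ) (hθ2 : θ < 2 * π) (ht : t = Real.tan (θ / 4))
    (hRa : 0 < Ra)
    (hωaB : dist B Oa = Ra) (hωaC : dist C Oa = Ra)
    (hρ : 0 < ρ)
    (hγin : Metric.sphere Da ρ ⊆ convexHull ℝ ({A, B, C} : Set Plane))
    (hγAB : Metric.infDist Da (affineSpan ℝ ({A, B} : Set Plane) : Set Plane) = ρ)
    (hγAC : Metric.infDist Da (affineSpan ℝ ({A, C} : Set Plane) : Set Plane) = ρ)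
    (hext : dist Oa Da = Ra + ρ)
    (hTω : dist Ta Oa = Ra)
    (hTin : Ta ∈ interior (convexHull ℝ ({A, B, C} : Set Plane)))
    (hang : ∠ B Ta C = π - θ / 2) :
    ∃ u v w, 0 < u ∧ 0 < v ∧ 0 < w ∧ dist B C = v + w ∧ dist C A = u + w ∧ dist A B = u + v ∧
      r ^ 2 * (u + v + w) = u * v * w ∧
      (v + w) * (u + w) * (u + v) = 4 * R * r * (u + v + w) ∧
      ρ = r * (1 - t * (r / u)) := by
  obtain ⟨X, Y, F, hXB, hYB, hXC, hYC, hYA, ha⟩ := tr_frame A B C hABC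
  have hAB : 0 < dist A B := by
    apply dist_pos.2
    rintro rfl
    linarith
  have hCA : 0 < dist C A := by
    apply dist_pos.2
    rintro rfl
    linarith
  have hBAs := F.dsq A B
  have hCAs := F.dsq C A
  have eI1 := tr_infDist F A B I r hAB hIab
  have eI2 := tr_infDist F B C I r ha hIbc
  have eI3 := tr_infDist F C A I r hCA hIca
  have eD1 := tr_infDist F A B Da ρ hAB hγAB
  have eD2 := tr_infDist F C A Da ρ hCA (by rw [Set.pair_comm]; exact hγAC)
  have dBO := F.dsq B O
  have dCO := F.dsq C O
  have dAO := F.dsq A O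
  have dB := F.dsq B Oa
  have dC := F.dsq C Oa
  have dT := F.dsq Ta Oa
  have dTB := F.dsq Ta B
  have dTC := F.dsq Ta C
  have dD := F.dsq Oa Da
  have hIh := interior_subset hIin
  have hDh := tr_center _ (convex_convexHull ℝ _) Da ρ hρ hγin
  -- half-planes
  have H1 : ∀ P ∈ convexHull ℝ ({A, B, C} : Set Plane), 0 ≤ Y P := by
    intro P hP
    have := tr_half F A B C 0 1 0 (by simp; exact hYA.le) (by simp [hYB]) (by simp [hYC]) P hP
    simpa using this
  have H2 : ∀ P ∈ convexHull ℝ ({A, B, C} : Set Plane), 0 ≤ Y A * X P - X A * Y P := by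
    intro P hP
    have := tr_half F A B C (Y A) (-X A) 0 (le_of_eq (by ring)) (by simp [hYB, hXB])
      (by rw [hYC, hXC]; simp; positivity) P hP
    linarith
  have H3 : ∀ P ∈ convexHull ℝ ({A, B, C} : Set Plane),
      0 ≤ Y A * (X C - X P) + (X A - X C) * Y P := by
    intro P hP
    have := tr_half F A B C (-Y A) (X A - X C) (Y A * X C) (le_of_eq (by ring))
      (by rw [hYB, hXB, hXC]; simp; positivity)
      (by rw [hYC, hXC]; apply le_of_eq; ring) P hP
    linarith
  have hYD : ρ ≤ Y Da := by
    obtain ⟨Q, hQ1, hQ2⟩ := F.sh Da (-ρ)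
    have hd := F.dsq Q Da
    rw [hQ1, hQ2] at hd
    have : dist Q Da = ρ := by
      rw [← sq_eq_sq₀ dist_nonneg hρ.le, hd]; ring
    have := H1 Q (hγin this)
    linarith
  have hYT : 0 < Y Ta := by
    obtain ⟨ε, hε, hb⟩ := Metric.isOpen_iff.1 isOpen_interior Ta hTin
    obtain ⟨Q, hQ1, hQ2⟩ := F.sh Ta (-(ε / 2))
    have hd := F.dsq Q Ta
    rw [hQ1, hQ2] at hd
    have : dist Q Ta = ε / 2 := by
      rw [← sq_eq_sq₀ dist_nonneg (by positivity), hd]; ring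
    have := H1 Q (interior_subset (hb (by rw [Metric.mem_ball]; linarith)))
    linarith
  -- angle
  have hpi := Real.pi_pos
  have hcos : 0 < Real.cos (θ / 4) := Real.cos_pos_of_mem_Ioo ⟨by linarith, by linarith⟩
  have hsin : 0 < Real.sin (θ / 4) := Real.sin_pos_of_pos_of_lt_pi (by linarith) (by linarith)
  have htpos : 0 < t := by rw [ht, Real.tan_eq_sin_div_cos]; positivity
  have hts : t * Real.cos (θ / 4) = Real.sin (θ / 4) := by
    rw [ht]; exact Real.tan_mul_cos hcos.ne'
  have hlaw := EuclideanGeometry.law_cos B Ta C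
  have hsinpos : 0 < Real.sin (π - θ / 2) :=
    Real.sin_pos_of_pos_of_lt_pi (by linarith) (by linarith)
  have hsc := Real.sin_sq_add_cos_sq (π - θ / 2)
  have hS : Real.sin (π - θ / 2) = 2 * t * Real.cos (θ / 4) ^ 2 := by
    rw [Real.sin_pi_sub, show θ / 2 = 2 * (θ / 4) by ring, Real.sin_two_mul, ← hts]; ring
  have hK : Real.cos (π - θ / 2) = (t ^ 2 - 1) * Real.cos (θ / 4) ^ 2 := by
    rw [Real.cos_pi_sub, show θ / 2 = 2 * (θ / 4) by ring, Real.cos_two_mul', ← hts]; ring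
  rw [hang] at hlaw
  rw [dist_comm B Ta, dist_comm C Ta] at hlaw
  obtain ⟨a, hade⟩ : ∃ a, a = dist B C := ⟨_, rfl⟩
  obtain ⟨b, hb⟩ : ∃ b, b = dist C A := ⟨_, rfl⟩
  obtain ⟨c, hc⟩ : ∃ c, c = dist A B := ⟨_, rfl⟩
  simp only [hXB, hYB, hXC, hYC, ← hade, ← hb, ← hc] at ha hAB hCA hBAs hCAs eI1 eI2 eI3 eD1 eD2 dBO dCO dAO dB dC dT dTB dTC dD H3 hlaw
  clear hXC
  simp only [← hade, ← hb, ← hc]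
  have hXOa : X Oa = a / 2 := by
    have : a * (X Oa - a / 2) = 0 := by
      rw [hωaB] at dB; rw [hωaC] at dC; linarith
    rcases mul_eq_zero.1 this with h | h <;> linarith
  have hXO : X O = a / 2 := by
    have : a * (X O - a / 2) = 0 := by
      rw [hOB] at dBO; rw [hOC] at dCO; linarith
    rcases mul_eq_zero.1 this with h | h <;> linarith
  have cI1 : Y A * X I - X A * Y I = r * c := by
    rw [← sq_eq_sq₀ (H2 I hIh) (by positivity), ← eI1]; ring
  have cI2 : Y I = r := by
    have : a * Y I = r * a := by
      rw [← sq_eq_sq₀ (mul_nonneg ha.le (H1 I hIh)) (by positivity), ← eI2]; ring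
    have : a * (Y I - r) = 0 := by linarith
    rcases mul_eq_zero.1 this with h | h <;> linarith
  have cI3 : Y A * (a - X I) + (X A - a) * Y I = r * b := by
    rw [← sq_eq_sq₀ (H3 I hIh) (by positivity), ← eI3]; ring
  have cD1 : Y A * X Da - X A * Y Da = ρ * c := by
    rw [← sq_eq_sq₀ (H2 Da hDh) (by positivity), ← eD1]; ring
  have cD3 : Y A * (a - X Da) + (X A - a) * Y Da = ρ * b := by
    rw [← sq_eq_sq₀ (H3 Da hDh) (by positivity), ← eD2]; ring
  have hYOa : 4 * Y Oa * t = a * (t ^ 2 - 1) := by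
    obtain ⟨N, hN⟩ : ∃ N, N = dist Ta B * dist Ta C := ⟨_, rfl⟩
    have hN0 : 0 ≤ N := by rw [hN]; positivity
    rw [hωaB] at dB
    rw [hTω] at dT
    rw [hXOa] at dB dT
    have e1 : N * Real.cos (π - θ / 2) = 2 * Y Oa * Y Ta := by
      rw [hN]; linarith
    have e2 : N ^ 2 = (2 * Y Oa * Y Ta) ^ 2 + (a * Y Ta) ^ 2 := by
      have : 2 * Y Oa * Y Ta = X Ta * (X Ta - a) + Y Ta ^ 2 := by linarith
      rw [this, hN, mul_pow, dTB, dTC]; ring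
    have e3 : N * Real.sin (π - θ / 2) = a * Y Ta := by
      rw [← sq_eq_sq₀ (by positivity) (by positivity)]
      rw [← e1] at e2
      linear_combination e2 + N ^ 2 * hsc
    rw [hS] at e3
    rw [hK] at e1
    have e4 : (Y Ta * Real.cos (θ / 4) ^ 2) * (4 * Y Oa * t - a * (t ^ 2 - 1)) = 0 := by
      linear_combination (-2 * t * Real.cos (θ / 4) ^ 2) * e1 + ((t ^ 2 - 1) * Real.cos (θ / 4) ^ 2) * e3
    rcases mul_eq_zero.1 e4 with h | h
    · exact absurd h (by positivity)
    · linarith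
  have hh : Y Oa = a * (t - 1 / t) / 4 := by field_simp; linarith
  have hRae : Ra = a * (t + 1 / t) / 4 := by
    rw [← sq_eq_sq₀ hRa.le (by positivity), ← hωaB, dB, hXOa, hh]
    field_simp; ring
  -- triangle quantities
  have harea : a * Y A = r * (a + b + c) := by rw [cI2] at cI1 cI3; linarith
  have hc2 : c ^ 2 = X A ^ 2 + Y A ^ 2 := by linarith
  have hb2 : b ^ 2 = (X A - a) ^ 2 + Y A ^ 2 := by linarith
  have hY2 : 0 < Y A ^ 2 := by positivity
  have q1 := abs_lt_of_sq_lt_sq' (show X A ^ 2 < c ^ 2 by linarith) hAB.le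
  have q2 := abs_lt_of_sq_lt_sq' (show (X A - a) ^ 2 < b ^ 2 by linarith) hCA.le
  have hu : 0 < (b + c - a) / 2 := by linarith [q1.2, q2.1]
  have hv : 0 < (a + c - b) / 2 := by
    have : b ^ 2 < (a + c) ^ 2 := by
      have := mul_pos ha (show 0 < c + X A by linarith [q1.1])
      linarith
    have := lt_of_pow_lt_pow_left₀ 2 (by positivity) this
    linarith
  have hw : 0 < (a + b - c) / 2 := by
    have : c ^ 2 < (a + b) ^ 2 := by
      have := mul_pos ha (show 0 < b - (X A - a) by linarith [q2.2])
      linarith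
    have := lt_of_pow_lt_pow_left₀ 2 (by positivity) this
    linarith
  obtain ⟨u, hud⟩ : ∃ u, u = (b + c - a) / 2 := ⟨_, rfl⟩
  obtain ⟨v, hvd⟩ : ∃ v, v = (a + c - b) / 2 := ⟨_, rfl⟩
  obtain ⟨w, hwd⟩ : ∃ w, w = (a + b - c) / 2 := ⟨_, rfl⟩
  rw [← hud] at hu
  rw [← hvd] at hv
  rw [← hwd] at hw
  have ea : a = v + w := by linarith
  have eb : b = u + w := by linarith
  have ec : c = u + v := by linarith
  clear hud hvd hwd hlaw
  have hxA : X A * (v + w) = (v + w) * v + u * (v - w) := by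
    rw [eb, ea] at hb2; rw [ec] at hc2; linarith
  have hyA : Y A * (v + w) = 2 * r * (u + v + w) := by
    rw [ea, eb, ec] at harea; linarith
  have hHeron : r ^ 2 * (u + v + w) = u * v * w := by
    have h1 : (u + v) ^ 2 * (v + w) ^ 2 = (X A * (v + w)) ^ 2 + (Y A * (v + w)) ^ 2 := by
      rw [ec] at hc2; rw [hc2]; ring
    rw [hxA, hyA] at h1
    have h2 : (4 * (u + v + w)) * (r ^ 2 * (u + v + w) - u * v * w) = 0 := by
      linear_combination -h1
    rcases mul_eq_zero.1 h2 with h | h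
    · exact absurd h (by positivity)
    · linarith
  refine ⟨u, v, w, hu, hv, hw, ea, eb, ec, hHeron, ?_, ?_⟩
  · have h1 : 2 * R * Y A = b * c := by
      rw [← sq_eq_sq₀ (by positivity) (by positivity)]
      rw [hOB, hXO] at dBO
      rw [hOA, hXO] at dAO
      have g1 : X A ^ 2 - a * X A + Y A ^ 2 = 2 * Y O * Y A := by linarith
      have : (2 * R * Y A) ^ 2 = (2 * Y O * Y A) ^ 2 + (a * Y A) ^ 2 := by
        linear_combination 4 * Y A ^ 2 * dBO
      rw [this, ← g1, mul_pow b c, hb2, hc2]; ring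
    rw [eb, ec] at h1
    linear_combination (-(v + w)) * h1 + 2 * R * hyA
  · have hk : ρ / r = 1 - t * (r / u) := by
      have hxI : X I = v := by
        rw [cI2, ec] at cI1
        have : (Y A * (v + w)) * (X I - v) = 0 := by
          have h3 : Y A * (v + w) * X I = r * (u + v) * (v + w) + r * (X A * (v + w)) := by
            linear_combination (v + w) * cI1
          linear_combination h3 + r * hxA - v * hyA
        rcases mul_eq_zero.1 this with h | h
        · exact absurd h (by positivity)
        · linarith
      have hyD : Y Da = Y A + (ρ / r) * (r - Y A) := by
        have : a * (Y Da - Y A) * r = a * ρ * (r - Y A) := by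
          linear_combination (-r) * (cD1 + cD3) - (-ρ) * (harea)
        have h2 : (Y Da - Y A) * r = ρ * (r - Y A) := by
          apply mul_left_cancel₀ ha.ne'; linarith
        field_simp; linarith
      have hxD : X Da = X A + (ρ / r) * (v - X A) := by
        have h1 : Y A * X Da = ρ * c + X A * (Y A + (ρ / r) * (r - Y A)) := by
          rw [← hyD]; linarith
        rw [cI2, hxI] at cI1
        have h2 : ρ * c = (ρ / r) * (r * c) := by field_simp
        apply mul_left_cancel₀ hYA.ne'
        rw [h1, h2, ← cI1]; ring
      have hk1 : ρ / r ≤ 1 := by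
        have hAr : r < Y A := by
          have : 0 < (v + w) * (Y A - r) := by
            have : (v + w) * (Y A - r) = r * (2 * u + v + w) := by linear_combination hyA
            rw [this]; positivity
          have := pos_of_mul_pos_right this (by positivity)
          linarith
        have hrr : ρ = (ρ / r) * r := by field_simp
        by_contra hcon
        push Not at hcon
        linarith [mul_pos (sub_pos.2 hcon) (hr.trans hAr)]
      rw [ea] at hh hRae hXOa
      apply tr_alg v w r t (ρ / r) (X A) (Y A) (X Da) (Y Da) (Y Oa) Ra u hv hw hr htpos hu hHeron
        hxA hyA hxD hyD hh hRae hk1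
      rw [hext, hXOa] at dD
      have hrr : (ρ / r) * r = ρ := by field_simp
      rw [hrr, dD]; ring
    field_simp at hk ⊢
    linarith

/-- For a general triad of Ajima circles `γ_a, γ_b, γ_c` (arcs of common angular
measure `θ`, `t = tan(θ/4)`), the radii satisfy
`ρ_a + ρ_b + ρ_c = 3r − r·t·(4R + r)/p`. -/
theorem triad_radii_sum
    (A B C I O Oa Ob Oc Da Db Dc Ta Tb Tc : Plane)
    (r R p θ t Ra Rb Rc ρa ρb ρc : ℝ)
    (hABC : AffineIndependent ℝ ![A, B, C])
    -- incenter and inradius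
    (hr : 0 < r)
    (hIin : I ∈ interior (convexHull ℝ ({A, B, C} : Set Plane)))
    (hIab : Metric.infDist I (affineSpan ℝ ({A, B} : Set Plane) : Set Plane) = r)
    (hIbc : Metric.infDist I (affineSpan ℝ ({B, C} : Set Plane) : Set Plane) = r)
    (hIca : Metric.infDist I (affineSpan ℝ ({C, A} : Set Plane) : Set Plane) = r)
    -- circumradius
    (hR : 0 < R)
    (hOA : dist A O = R) (hOB : dist B O = R) (hOC : dist C O = R)
    -- semiperimeter
    (hp : p = (dist A B + dist B C + dist C A) / 2)
    -- the common angular measure θ and t = tan(θ/4)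
    (hθ0 : 0 < θ) (hθ2 : θ < 2 * π) (ht : t = Real.tan (θ / 4))
    -- the three arcs' circles
    (hRa : 0 < Ra) (hRb : 0 < Rb) (hRc : 0 < Rc)
    (hωaB : dist B Oa = Ra) (hωaC : dist C Oa = Ra)
    (hωbC : dist C Ob = Rb) (hωbA : dist A Ob = Rb)
    (hωcA : dist A Oc = Rc) (hωcB : dist B Oc = Rc)
    -- the triad circle γ_a
    (hρa : 0 < ρa)
    (hγain : Metric.sphere Da ρa ⊆ convexHull ℝ ({A, B, C} : Set Plane))
    (hγaAB : Metric.infDist Da (affineSpan ℝ ({A, B} : Set Plane) : Set Plane) = ρa)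
    (hγaAC : Metric.infDist Da (affineSpan ℝ ({A, C} : Set Plane) : Set Plane) = ρa)
    (hexta : dist Oa Da = Ra + ρa)
    (hTaω : dist Ta Oa = Ra) (hTaγ : dist Ta Da = ρa)
    (hTaseg : Wbtw ℝ Oa Ta Da)
    (hTain : Ta ∈ interior (convexHull ℝ ({A, B, C} : Set Plane)))
    -- the triad circle γ_b
    (hρb : 0 < ρb)
    (hγbin : Metric.sphere Db ρb ⊆ convexHull ℝ ({A, B, C} : Set Plane))
    (hγbBC : Metric.infDist Db (affineSpan ℝ ({B, C} : Set Plane) : Set Plane) = ρb)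
    (hγbBA : Metric.infDist Db (affineSpan ℝ ({B, A} : Set Plane) : Set Plane) = ρb)
    (hextb : dist Ob Db = Rb + ρb)
    (hTbω : dist Tb Ob = Rb) (hTbγ : dist Tb Db = ρb)
    (hTbseg : Wbtw ℝ Ob Tb Db)
    (hTbin : Tb ∈ interior (convexHull ℝ ({A, B, C} : Set Plane)))
    -- the triad circle γ_c
    (hρc : 0 < ρc)
    (hγcin : Metric.sphere Dc ρc ⊆ convexHull ℝ ({A, B, C} : Set Plane))
    (hγcCA : Metric.infDist Dc (affineSpan ℝ ({C, A} : Set Plane) : Set Plane) = ρc)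
    (hγcCB : Metric.infDist Dc (affineSpan ℝ ({C, B} : Set Plane) : Set Plane) = ρc)
    (hextc : dist Oc Dc = Rc + ρc)
    (hTcω : dist Tc Oc = Rc) (hTcγ : dist Tc Dc = ρc)
    (hTcseg : Wbtw ℝ Oc Tc Dc)
    (hTcin : Tc ∈ interior (convexHull ℝ ({A, B, C} : Set Plane)))
    -- all three arcs have angular measure θ
    (hanga : ∠ B Ta C = π - θ / 2)
    (hangb : ∠ C Tb A = π - θ / 2)
    (hangc : ∠ A Tc B = π - θ / 2)
 :
    ρa + ρb + ρc = 3 * r - r * t * (4 * R + r) / p := by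
  have hABC2 : AffineIndependent ℝ ![B, C, A] := by
    rw [affineIndependent_iff_not_collinear_set] at *
    rwa [show ({B, C, A} : Set Plane) = {A, B, C} by ext; simp; tauto]
  have hABC3 : AffineIndependent ℝ ![C, A, B] := by
    rw [affineIndependent_iff_not_collinear_set] at *
    rwa [show ({C, A, B} : Set Plane) = {A, B, C} by ext; simp; tauto]
  have s2 : ({A, B, C} : Set Plane) = {B, C, A} := by ext; simp; tauto
  have s3 : ({A, B, C} : Set Plane) = {C, A, B} := by ext; simp; tauto
  obtain ⟨u, v, w, hu, hv, hw, e1, e2, e3, hH, hRR, h1⟩ := tr_key A B C I O Oa Da Ta r R θ t Ra ρa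
    hABC hr hIin hIab hIbc hIca hR hOA hOB hOC hθ0 hθ2 ht hRa hωaB hωaC hρa hγain hγaAB hγaAC hexta
    hTaω hTain hanga
  obtain ⟨u', v', w', -, -, -, f1, f2, f3, -, -, h2⟩ := tr_key B C A I O Ob Db Tb r R θ t Rb ρb
    hABC2 hr (s2 ▸ hIin) hIbc hIca hIab hR hOB hOC hOA hθ0 hθ2 ht hRb hωbC hωbA hρb (s2 ▸ hγbin)
    hγbBC hγbBA hextb hTbω (s2 ▸ hTbin) hangb
  obtain ⟨u'', v'', w'', -, -, -, g1, g2, g3, -, -, h3⟩ := tr_key C A B I O Oc Dc Tc r R θ t Rc ρc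
    hABC3 hr (s3 ▸ hIin) hIca hIab hIbc hR hOC hOA hOB hθ0 hθ2 ht hRc hωcA hωcB hρc (s3 ▸ hγcin)
    hγcCA hγcCB hextc hTcω (s3 ▸ hTcin) hangc
  have k2 : u' = v := by linarith
  have k3 : u'' = w := by linarith
  have hpe : p = u + v + w := by linarith
  have hsum : r * (4 * R + r) = v * w + u * w + u * v := by
    have : (u + v + w) * (r * (4 * R + r) - (v * w + u * w + u * v)) = 0 := by
      linear_combination hH - hRR
    rcases mul_eq_zero.1 this with h | h
    · exact absurd h (by positivity)
    · linarith
  have hq : (4 * R + r) / p = r / u + r / v + r / w := by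
    rw [hpe]
    have hr2 : 4 * R + r = (v * w + u * w + u * v) / r := by field_simp; linarith
    rw [hr2]
    rw [div_div, div_add_div _ _ hu.ne' hv.ne', div_add_div _ _ (by positivity) hw.ne',
      div_eq_div_iff (by positivity) (by positivity)]
    linear_combination (-(v * w + u * w + u * v)) * hH
  rw [h1, h2, h3, k2, k3, mul_div_assoc, hq]
  ring
end
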